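/- There exist absolute constants α, C, c > 0 such that lim_{n→∞} inf_{λ} P( c·(log n)^3 ≤ L(n,λ) ≤ C·(log n)^3 ) = 1, where the infimum is over all λ with e^{−1} − (log n)^{−2} ≤ λ ≤ e^{−1} + α·(log n)^{−2}. -/

import Mathlib

open MeasureTheory ProbabilityTheory Filter Finset

namespace Paper

/-- A path of length `ℓ` in the complete graph on `Fin n`: a sequence of `ℓ+1` distinct
vertices. -/
abbrev Path (n ℓ : ℕ) := {v : Fin (ℓ + 1) → Fin n // Function.Injective v}

/-- The `i`-th edge of a path. -/
def Path.edge {n ℓ : ℕ} (γ : Path n ℓ) (i : Fin ℓ) : Sym2 (Fin n) :=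
  s(γ.1 i.castSucc, γ.1 i.succ)

/-- The total weight `X(γ)` of a path. -/
noncomputable def weight {n ℓ : ℕ} (ω : Sym2 (Fin n) → ℝ) (γ : Path n ℓ) : ℝ :=
  ∑ i : Fin ℓ, ω (γ.edge i)

/-- Partial sum of the first `k` edge weights of a path. -/
noncomputable def partialSum {n ℓ : ℕ} (ω : Sym2 (Fin n) → ℝ) (γ : Path n ℓ) (k : ℕ) : ℝ :=
  ∑ i : Fin ℓ, if (i : ℕ) < k then ω (γ.edge i) else 0

/-- The deviation `M(γ) = max_{1 ≤ k ≤ ℓ} |∑_{i=1}^k X_{e_i} - (k/ℓ) X(γ)|`. -/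
noncomputable def deviation {n ℓ : ℕ} (ω : Sym2 (Fin n) → ℝ) (γ : Path n ℓ) : ℝ :=
  ⨆ k : Fin ℓ, |partialSum ω γ ((k : ℕ) + 1) - (((k : ℕ) + 1 : ℝ) / ℓ) * weight ω γ|

/-- The law of the i.i.d. edge weights: each edge carries an exponential variable with
mean `n` (rate `1/n`). -/
noncomputable def P (n : ℕ) : Measure (Sym2 (Fin n) → ℝ) :=
  Measure.pi fun _ => expMeasure ((n : ℝ)⁻¹)

/-- `L n λ ω` : the maximal `ℓ` such that some path of length `ℓ` has weight at most `λℓ`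
(`0` if there is none). -/
noncomputable def L (n : ℕ) (lam : ℝ) (ω : Sym2 (Fin n) → ℝ) : ℕ :=
  sSup {ℓ : ℕ | ∃ γ : Path n ℓ, weight ω γ ≤ lam * ℓ}

section
lemma lintegral_mul_dep {ι : Type*} [Fintype ι] (μ : Measure ℝ) [IsProbabilityMeasure μ]
    (f g : (ι → ℝ) → ENNReal) (hf : Measurable f) (hg : Measurable g) (S T : Set ι)
    (hfS : DependsOn f S) (hgT : DependsOn g T) (hST : Disjoint S T) :
    ∫⁻ ω, f ω * g ω ∂(Measure.pi fun _ : ι => μ)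
      = (∫⁻ ω, f ω ∂(Measure.pi fun _ : ι => μ)) * ∫⁻ ω, g ω ∂(Measure.pi fun _ : ι => μ) := by
  classical
  have hind : iIndepFun (fun i (ω : ι → ℝ) => ω i) (Measure.pi fun _ : ι => μ) :=
    iIndepFun_pi (X := fun _ x => x) (fun i => aemeasurable_id)
  have h2 := hind.indepFun_finset S.toFinset T.toFinset
    (by rw [Set.disjoint_toFinset]; exact hST) (fun i => measurable_pi_apply i)
  let eS : (S.toFinset → ℝ) → (ι → ℝ) := fun x i => if h : i ∈ S.toFinset then x ⟨i, h⟩ else 0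
  let eT : (T.toFinset → ℝ) → (ι → ℝ) := fun x i => if h : i ∈ T.toFinset then x ⟨i, h⟩ else 0
  have meS : Measurable eS := by
    refine measurable_pi_lambda _ fun i => ?_
    by_cases h : i ∈ S.toFinset
    · simp only [eS, h, dif_pos]; exact measurable_pi_apply _
    · simp only [eS, h, dif_neg, not_false_eq_true]; exact measurable_const
  have meT : Measurable eT := by
    refine measurable_pi_lambda _ fun i => ?_
    by_cases h : i ∈ T.toFinset
    · simp only [eT, h, dif_pos]; exact measurable_pi_apply _
    · simp only [eT, h, dif_neg, not_false_eq_true]; exact measurable_const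
  have h3 := h2.comp (hf.comp meS) (hg.comp meT)
  have e1 : ((f ∘ eS) ∘ fun (a : ι → ℝ) (i : S.toFinset) => a i) = f := by
    funext ω
    refine hfS fun i hi => ?_
    simp [eS, hi]
  have e2 : ((g ∘ eT) ∘ fun (a : ι → ℝ) (i : T.toFinset) => a i) = g := by
    funext ω
    refine hgT fun i hi => ?_
    simp [eT, hi]
  rw [e1, e2] at h3
  exact lintegral_mul_eq_lintegral_mul_lintegral_of_indepFun'' hf.aemeasurable hg.aemeasurable h3

lemma lintegral_prod_dep {ι κ : Type*} [Fintype ι] (μ : Measure ℝ) [IsProbabilityMeasure μ]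
    (s : Finset κ) (f : κ → (ι → ℝ) → ENNReal) (S : κ → Set ι) (hf : ∀ k ∈ s, Measurable (f k))
    (hfS : ∀ k ∈ s, DependsOn (f k) (S k))
    (hST : ∀ j ∈ s, ∀ k ∈ s, j ≠ k → Disjoint (S j) (S k)) :
    ∫⁻ ω, ∏ k ∈ s, f k ω ∂(Measure.pi fun _ : ι => μ)
      = ∏ k ∈ s, ∫⁻ ω, f k ω ∂(Measure.pi fun _ : ι => μ) := by
  classical
  induction s using Finset.induction_on with
  | empty => simp
  | insert a s ha ih =>
    simp only [Finset.prod_insert ha]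
    rw [lintegral_mul_dep μ (f a) (fun ω => ∏ k ∈ s, f k ω) (hf a (by simp)) ?_ (S a)
      (⋃ k ∈ s, S k) (hfS a (by simp)) ?_ ?_, ih]
    · exact fun k hk => hf k (by simp [hk])
    · exact fun k hk => hfS k (by simp [hk])
    · exact fun j hj k hk => hST j (by simp [hj]) k (by simp [hk])
    · exact Finset.measurable_prod _ fun k hk => hf k (by simp [hk])
    · intro x y hxy
      refine Finset.prod_congr rfl fun k hk => hfS k (by simp [hk]) fun i hi => hxy i ?_
      exact Set.mem_biUnion hk hi
    · rw [Set.disjoint_iUnion₂_right]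
      intro k hk
      refine hST a (by simp) k (by simp [hk]) ?_
      rintro rfl; exact ha hk

lemma lintegral_eval {ι : Type*} [Fintype ι] (μ : Measure ℝ) [IsProbabilityMeasure μ]
    (i : ι) (g : ℝ → ENNReal) (hg : Measurable g) :
    ∫⁻ ω, g (ω i) ∂(Measure.pi fun _ : ι => μ) = ∫⁻ x, g x ∂μ :=
  (measurePreserving_eval (fun _ : ι => μ) i).lintegral_comp hg

/-- product of functions of distinct coordinates -/
lemma lintegral_prod_coord {ι : Type*} [Fintype ι] (μ : Measure ℝ) [IsProbabilityMeasure μ]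
    (s : Finset ι) (g : ι → ℝ → ENNReal) (hg : ∀ i, Measurable (g i)) :
    ∫⁻ ω, ∏ k ∈ s, g k (ω k) ∂(Measure.pi fun _ : ι => μ) = ∏ k ∈ s, ∫⁻ x, g k x ∂μ := by
  rw [lintegral_prod_dep μ s (fun k ω => g k (ω k)) (fun k => {k})]
  · exact Finset.prod_congr rfl fun k _ => lintegral_eval μ k _ (hg k)
  · exact fun k _ => (hg k).comp (measurable_pi_apply k)
  · intro k _ x y h; simp [h k rfl]
  · intro j _ k _ h; simpa using h

lemma expMeasure_eq (r : ℝ) : expMeasure r = volume.withDensity (exponentialPDF r) := rfl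

lemma lintegral_expMeasure (r : ℝ) (g : ℝ → ENNReal) (hg : Measurable g) :
    ∫⁻ x, g x ∂(expMeasure r)
      = ∫⁻ x in Set.Ioi 0, ENNReal.ofReal (r * Real.exp (-(r * x))) * g x := by
  rw [expMeasure_eq, lintegral_withDensity_eq_lintegral_mul _ _ hg,
    ← lintegral_add_compl _ (measurableSet_Ici (a := (0:ℝ)))]
  · have h1 : ∫⁻ x in (Set.Ici (0:ℝ))ᶜ, (exponentialPDF r * g) x = 0 := by
      rw [setLIntegral_congr_fun (g := fun _ => 0) measurableSet_Ici.compl]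
      · simp
      · intro x hx
        have : x < 0 := by simpa using hx
        simp [exponentialPDF_of_neg this]
    rw [h1, add_zero, setLIntegral_congr Ioi_ae_eq_Ici.symm]
    refine setLIntegral_congr_fun measurableSet_Ioi fun x hx => ?_
    simp only [Pi.mul_apply]
    rw [exponentialPDF_of_nonneg (le_of_lt hx)]
  · exact (measurable_exponentialPDFReal r).ennreal_ofReal

lemma lintegral_exp_neg (a : ℝ) (ha : 0 < a) :
    ∫⁻ x in Set.Ioi (0:ℝ), ENNReal.ofReal (Real.exp (-(a * x))) = ENNReal.ofReal (1 / a) := by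
  have h := integral_exp_mul_Ioi (a := -a) (by linarith) 0
  rw [← ofReal_integral_eq_lintegral_ofReal]
  · congr 1
    simp only [neg_mul] at h
    rw [h]; simp
  · have := integrableOn_exp_mul_Ioi (a := -a) (by linarith) 0
    simpa [IntegrableOn] using this
  · exact Eventually.of_forall fun x => (Real.exp_pos _).le

lemma laplace (r a : ℝ) (hr : 0 < r) (ha : 0 ≤ a) :
    ∫⁻ x, ENNReal.ofReal (Real.exp (-(a * x))) ∂(expMeasure r) = ENNReal.ofReal (r / (r + a)) := by
  rw [lintegral_expMeasure _ _ (by fun_prop)]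
  have : ∀ x : ℝ, ENNReal.ofReal (r * Real.exp (-(r * x))) * ENNReal.ofReal (Real.exp (-(a * x)))
      = ENNReal.ofReal r * ENNReal.ofReal (Real.exp (-((r + a) * x))) := by
    intro x
    rw [← ENNReal.ofReal_mul (by positivity), ← ENNReal.ofReal_mul hr.le, mul_assoc, ← Real.exp_add]
    congr 3; ring
  simp only [this]
  rw [lintegral_const_mul _ (by fun_prop), lintegral_exp_neg _ (by positivity),
    ← ENNReal.ofReal_mul hr.le]
  congr 1; ring

lemma laplace_n (n : ℕ) (hn : 0 < n) (a : ℝ) (ha : 0 ≤ a) :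
    ∫⁻ x, ENNReal.ofReal (Real.exp (-(a * x))) ∂(expMeasure ((n:ℝ)⁻¹))
      = ENNReal.ofReal (1 / (1 + a * n)) := by
  have hn' : (0:ℝ) < n := by exact_mod_cast hn
  rw [laplace _ _ (by positivity) ha]
  congr 1
  field_simp

lemma probExp (n : ℕ) (hn : 0 < n) : IsProbabilityMeasure (expMeasure ((n:ℝ)⁻¹)) :=
  isProbabilityMeasure_expMeasure (by positivity)

lemma probP (n : ℕ) (hn : 0 < n) : IsProbabilityMeasure (P n) := by
  have := probExp n hn
  unfold P; infer_instance

lemma edge_injective {n ℓ : ℕ} (γ : Path n ℓ) : Function.Injective γ.edge := by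
  intro i j h
  simp only [Path.edge, Sym2.eq_iff] at h
  rcases h with ⟨h, _⟩ | ⟨h1, h2⟩
  · have := γ.2 h
    exact Fin.castSucc_injective _ this
  · have h1 := congrArg Fin.val (γ.2 h1)
    have h2 := congrArg Fin.val (γ.2 h2)
    simp at h1 h2
    omega

lemma card_path_le (n ℓ : ℕ) : Fintype.card (Path n ℓ) ≤ n ^ (ℓ + 1) := by
  refine (Fintype.card_subtype_le _).trans ?_
  simp

lemma card_path (n ℓ : ℕ) : Fintype.card (Path n ℓ) = n.descFactorial (ℓ + 1) := by
  rw [← Fintype.card_congr (Equiv.subtypeInjectiveEquivEmbedding (Fin (ℓ+1)) (Fin n)).symm]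
  rw [Fintype.card_embedding_eq]; simp

lemma measurable_weight {n ℓ : ℕ} (γ : Path n ℓ) : Measurable fun ω => weight ω γ := by
  unfold weight
  exact Finset.measurable_sum _ fun i _ => measurable_pi_apply _

end

section
lemma lintegral_exp_sum {n ℓ : ℕ} (hn : 0 < n) (γ : Path n ℓ) (s : Finset (Fin ℓ)) (a : ℝ)
    (ha : 0 ≤ a) :
    ∫⁻ ω, ENNReal.ofReal (Real.exp (-(a * ∑ i ∈ s, ω (γ.edge i)))) ∂(P n)
      = ENNReal.ofReal ((1 / (1 + a * n)) ^ s.card) := by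
  have := probExp n hn
  have h1 : ∀ ω : Sym2 (Fin n) → ℝ, ENNReal.ofReal (Real.exp (-(a * ∑ i ∈ s, ω (γ.edge i))))
      = ∏ i ∈ s, ENNReal.ofReal (Real.exp (-(a * ω (γ.edge i)))) := by
    intro ω
    rw [← ENNReal.ofReal_prod_of_nonneg (fun i _ => (Real.exp_pos _).le), ← Real.exp_sum,
      Finset.mul_sum, Finset.sum_neg_distrib]
  simp only [h1]
  unfold P
  rw [lintegral_prod_dep _ s (fun i ω => ENNReal.ofReal (Real.exp (-(a * ω (γ.edge i)))))
    (fun i => {γ.edge i})]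
  · have h2 : ∀ i ∈ s, ∫⁻ ω, ENNReal.ofReal (Real.exp (-(a * ω (γ.edge i))))
        ∂(Measure.pi fun _ : Sym2 (Fin n) => expMeasure ((n:ℝ)⁻¹))
        = ENNReal.ofReal (1 / (1 + a * n)) := by
      intro i _
      rw [lintegral_eval _ (γ.edge i) (fun x => ENNReal.ofReal (Real.exp (-(a * x))))
        (by fun_prop), laplace_n n hn a ha]
    rw [Finset.prod_congr rfl h2, Finset.prod_const, ENNReal.ofReal_pow (by positivity)]
  · intro k _; fun_prop
  · intro k _ x y h; simp [h _ rfl]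
  · intro j _ k _ h; simpa using fun h' => h (edge_injective γ h')

/-- Markov bound for light paths -/
lemma light_path {n k : ℕ} (hn : 0 < n) (h : ℝ) (γ : Path n k) :
    P n {ω | Real.exp 1 * weight ω γ ≤ k - h}
      ≤ ENNReal.ofReal (Real.exp (-h) * (1 / (n:ℝ)) ^ k) := by
  have hn' : (0:ℝ) < n := by exact_mod_cast hn
  have hm : Measurable fun ω : Sym2 (Fin n) → ℝ =>
      ENNReal.ofReal (Real.exp (k - h)) *
        ENNReal.ofReal (Real.exp (-(Real.exp 1 * ∑ i ∈ univ, ω (γ.edge i)))) := by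
    fun_prop
  calc P n {ω | Real.exp 1 * weight ω γ ≤ k - h}
      ≤ P n {ω | 1 ≤ ENNReal.ofReal (Real.exp (k - h)) *
        ENNReal.ofReal (Real.exp (-(Real.exp 1 * ∑ i ∈ univ, ω (γ.edge i))))} := by
        refine measure_mono fun ω hω => ?_
        simp only [Set.mem_ofPred_eq] at hω ⊢
        rw [← ENNReal.ofReal_mul (Real.exp_pos _).le, ← Real.exp_add, ENNReal.one_le_ofReal,
          Real.one_le_exp_iff]
        unfold weight at hω
        linarith
    _ ≤ ∫⁻ ω, ENNReal.ofReal (Real.exp (k - h)) *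
        ENNReal.ofReal (Real.exp (-(Real.exp 1 * ∑ i ∈ univ, ω (γ.edge i)))) ∂(P n) := by
        simpa using mul_meas_ge_le_lintegral hm 1
    _ = ENNReal.ofReal (Real.exp (k - h) * (1 / (1 + Real.exp 1 * n)) ^ k) := by
        rw [lintegral_const_mul _ (by fun_prop), lintegral_exp_sum hn γ univ _ (Real.exp_pos _).le,
          ← ENNReal.ofReal_mul (Real.exp_pos _).le]
        simp
    _ ≤ _ := by
        apply ENNReal.ofReal_le_ofReal
        have h1 : Real.exp (k - h) = Real.exp (-h) * (Real.exp 1) ^ k := by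
          rw [← Real.exp_nat_mul, ← Real.exp_add]; congr 1; ring
        rw [h1, mul_assoc, ← mul_pow]
        refine mul_le_mul_of_nonneg_left ?_ (Real.exp_pos _).le
        refine pow_le_pow_left₀ (by positivity) ?_ _
        have := Real.exp_pos 1
        rw [mul_one_div, div_le_div_iff₀ (by positivity) hn']
        linarith

lemma light_any {n k : ℕ} (hn : 0 < n) (h : ℝ) :
    P n {ω | ∃ γ : Path n k, Real.exp 1 * weight ω γ ≤ k - h}
      ≤ ENNReal.ofReal (n * Real.exp (-h)) := by
  have hn' : (0:ℝ) < n := by exact_mod_cast hn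
  have : {ω | ∃ γ : Path n k, Real.exp 1 * weight ω γ ≤ k - h}
      = ⋃ γ : Path n k, {ω | Real.exp 1 * weight ω γ ≤ k - h} := by
    ext ω; simp
  rw [this]
  refine (measure_iUnion_le _).trans ?_
  rw [tsum_fintype]
  refine (Finset.sum_le_sum fun γ _ => light_path hn h γ).trans ?_
  rw [Finset.sum_const, nsmul_eq_mul, Finset.card_univ]
  calc (Fintype.card (Path n k) : ENNReal) * ENNReal.ofReal (Real.exp (-h) * (1 / (n:ℝ)) ^ k)
      ≤ ENNReal.ofReal ((n:ℝ) ^ (k+1)) * ENNReal.ofReal (Real.exp (-h) * (1 / (n:ℝ)) ^ k) := by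
        gcongr
        rw [← ENNReal.ofReal_natCast]
        apply ENNReal.ofReal_le_ofReal
        exact_mod_cast card_path_le n k
    _ = _ := by
        rw [← ENNReal.ofReal_mul (by positivity)]
        congr 1
        rw [pow_succ, one_div, inv_pow]
        field_simp

lemma log_bd (w : ℝ) (h0 : 0 ≤ w) (h1 : w < 1) :
    |Real.log (1 + w) - (w - w ^ 2 / 2)| ≤ w ^ 3 / (1 - w) := by
  have := Real.abs_log_sub_add_sum_range_le (x := -w) (by rw [abs_neg, abs_of_nonneg h0]; exact h1) 2
  simp [Finset.sum_range_succ, abs_of_nonneg h0] at this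
  norm_num at this
  convert this using 2
  ring

/-- numerics for one block -/
lemma block_num (n m : ℕ) (hn : 0 < n) (hm : 1000000 ≤ m) (hmn : 1000 * m ≤ n) (θ : ℝ) (hθ : θ = 1 / Real.sqrt m) :
    36 * (1 / (1 + Real.exp 1 * n)) ^ m
      + Real.exp (2 * θ * m) * (1 / (1 + Real.exp 1 * (1 + 2 * θ) * n)) ^ m
      - 12 * (Real.exp (θ * m) * (1 / (1 + Real.exp 1 * (1 + θ) * n)) ^ m)
      ≤ 24 * (1 / (Real.exp 1 * n)) ^ m := by
  have hn' : (0:ℝ) < n := by exact_mod_cast hn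
  have hm' : (1000000:ℝ) ≤ m := by exact_mod_cast hm
  have hmn' : (1000:ℝ) * m ≤ n := by exact_mod_cast hmn
  have hE : (2:ℝ) ≤ Real.exp 1 := by have := Real.add_one_le_exp (1:ℝ); linarith
  have hsm : (1000:ℝ) ≤ Real.sqrt m := by
    rw [Real.le_sqrt (by norm_num) (by linarith)]; linarith
  have hθ0 : 0 < θ := by rw [hθ]; positivity
  have hθ1 : θ ≤ 1 / 1000 := by
    rw [hθ]; exact one_div_le_one_div_of_le (by norm_num) hsm
  have hmθ : m * θ ^ 2 = 1 := by
    rw [hθ, div_pow, Real.sq_sqrt (by linarith)]; field_simp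
  set E := Real.exp 1 with hEdef
  have hEn : 0 < E * n := by positivity
  set X := (1 / (E * n)) ^ m with hX
  have hX0 : 0 < X := by positivity
  have a0 : (1 / (1 + E * n)) ^ m ≤ X := by
    apply pow_le_pow_left₀ (by positivity)
    exact one_div_le_one_div_of_le hEn (by linarith)
  -- second moment
  have a2 : Real.exp (2 * θ * m) * (1 / (1 + E * (1 + 2 * θ) * n)) ^ m ≤ 7.5 * X := by
    have h1 : (1 / (1 + E * (1 + 2 * θ) * n)) ^ m ≤ Real.exp (-(m * Real.log (1 + 2 * θ))) * X := by
      have h2 : Real.exp (-(m * Real.log (1 + 2 * θ))) = (1 / (1 + 2 * θ)) ^ m := by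
        rw [← mul_neg, Real.exp_nat_mul, Real.exp_neg, Real.exp_log (by positivity), one_div]
      rw [h2, hX, ← mul_pow]
      apply pow_le_pow_left₀ (by positivity)
      rw [one_div_mul_one_div]
      exact one_div_le_one_div_of_le (by positivity) (by nlinarith)
    have hl := (abs_le.1 (log_bd (2 * θ) (by linarith) (by linarith))).1
    have hl2 : (2 * θ) ^ 3 / (1 - 2 * θ) ≤ 9 * θ ^ 3 := by
      rw [div_le_iff₀ (by linarith)]; nlinarith [pow_pos hθ0 3]
    calc Real.exp (2 * θ * m) * (1 / (1 + E * (1 + 2 * θ) * n)) ^ m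
        ≤ Real.exp (2 * θ * m) * (Real.exp (-(m * Real.log (1 + 2 * θ))) * X) := by gcongr
      _ = Real.exp (m * (2 * θ - Real.log (1 + 2 * θ))) * X := by
          rw [← mul_assoc, ← Real.exp_add]; congr 2; ring
      _ ≤ Real.exp (2 + 9 / 1000) * X := by
          gcongr
          calc m * (2 * θ - Real.log (1 + 2 * θ)) ≤ m * (2 * θ ^ 2 + 9 * θ ^ 3) := by
                apply mul_le_mul_of_nonneg_left _ (by linarith); linarith
            _ = 2 * (m * θ ^ 2) + 9 * θ * (m * θ ^ 2) := by ring
            _ ≤ _ := by rw [hmθ]; linarith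
      _ ≤ 7.5 * X := by
          gcongr
          have h3 : Real.exp (2 + 9 / 1000) = E ^ 2 * Real.exp (9 / 1000) := by
            rw [Real.exp_add, hEdef, ← Real.exp_nat_mul]; norm_num
          have h4 : Real.exp (9 / 1000) ≤ 1.01 := by
            have := Real.exp_bound' (x := 9 / 1000) (by norm_num) (by norm_num) (n := 2) (by norm_num)
            norm_num [Finset.sum_range_succ, Nat.factorial] at this
            linarith
          have h5 := Real.exp_one_lt_d9
          rw [h3]
          calc E ^ 2 * Real.exp (9 / 1000) ≤ 2.7183 ^ 2 * 1.01 := by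
                gcongr; linarith
            _ ≤ 7.5 := by norm_num
  have a1 : 1.63 * X ≤ Real.exp (θ * m) * (1 / (1 + E * (1 + θ) * n)) ^ m := by
    have h1 : Real.exp (-(m * (Real.log (1 + θ) + 1 / n))) * X
        ≤ (1 / (1 + E * (1 + θ) * n)) ^ m := by
      have h2 : Real.exp (-(m * (Real.log (1 + θ) + 1 / n)))
          = (1 / ((1 + θ) * Real.exp (1 / n))) ^ m := by
        rw [← mul_neg, Real.exp_nat_mul, Real.exp_neg, Real.exp_add, Real.exp_log (by positivity), one_div ((1 + θ) * _)]
      rw [h2, hX, ← mul_pow]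
      apply pow_le_pow_left₀ (by positivity)
      rw [one_div_mul_one_div]
      apply one_div_le_one_div_of_le (by positivity)
      have h3 := Real.add_one_le_exp (1 / (n:ℝ))
      have h4 : (1 / (n:ℝ)) * n = 1 := by field_simp
      calc 1 + E * (1 + θ) * n ≤ (1 + θ) * (1 / n + 1) * (E * n) := by
            have : (1 + θ) * (1 / n + 1) * (E * n) = (1 + θ) * E * (1 / n * n) + (1 + θ) * E * n := by
              ring
            rw [this, h4]; nlinarith
        _ ≤ _ := by gcongr
    have hl := (abs_le.1 (log_bd θ (by linarith) (by linarith))).2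
    have hl2 : θ ^ 3 / (1 - θ) ≤ 2 * θ ^ 3 := by
      rw [div_le_iff₀ (by linarith)]; nlinarith [pow_pos hθ0 3]
    have h6 : (m:ℝ) * (1 / n) ≤ 1 / 1000 := by
      rw [mul_one_div, div_le_div_iff₀ hn' (by norm_num)]; linarith
    calc 1.63 * X ≤ Real.exp (496 / 1000) * X := by
          gcongr
          have := Real.sum_le_exp_of_nonneg (x := 496 / 1000) (by norm_num) 4
          norm_num [Finset.sum_range_succ, Nat.factorial] at this
          linarith
      _ ≤ Real.exp (m * (θ - Real.log (1 + θ) - 1 / n)) * X := by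
          gcongr
          calc (496 / 1000:ℝ) ≤ 1/2 * (m * θ ^ 2) - 2 * θ * (m * θ^2) - m * (1 / n) := by
                rw [hmθ]; linarith
            _ = m * (θ ^ 2 / 2 - 2 * θ ^ 3 - 1 / n) := by ring
            _ ≤ _ := by
              apply mul_le_mul_of_nonneg_left _ (by linarith); linarith
      _ = Real.exp (θ * m) * (Real.exp (-(m * (Real.log (1 + θ) + 1 / n))) * X) := by
          rw [← mul_assoc, ← Real.exp_add]; congr 2; ring
      _ ≤ _ := by gcongr
  linarith

/-- expectation of one block -/
lemma block_int {n ℓ m : ℕ} (hn : 0 < n) (hm : 1000000 ≤ m) (hmn : 1000 * m ≤ n)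
    (θ : ℝ) (hθ : θ = 1 / Real.sqrt m) (γ : Path n ℓ) (s : Finset (Fin ℓ)) (hs : s.card = m) :
    ∫⁻ ω, ENNReal.ofReal (Real.exp (-(Real.exp 1 * ∑ i ∈ s, ω (γ.edge i))) *
        (6 - Real.exp (-(θ * (Real.exp 1 * ∑ i ∈ s, ω (γ.edge i) - m)))) ^ 2) ∂(P n)
      ≤ ENNReal.ofReal (24 * (1 / (Real.exp 1 * n)) ^ m) := by
  have hθ0 : 0 ≤ θ := by rw [hθ]; positivity
  have hE := Real.exp_pos 1
  set E := Real.exp 1 with hEdef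
  let Sf : (Sym2 (Fin n) → ℝ) → ℝ := fun ω => ∑ i ∈ s, ω (γ.edge i)
  have hSf : Measurable Sf := by
    exact Finset.measurable_sum _ fun i _ => measurable_pi_apply _
  have key : ∀ c : ℝ, 0 ≤ c → ∫⁻ ω, ENNReal.ofReal (Real.exp (-((E * (1 + c)) * Sf ω))) ∂(P n)
      = ENNReal.ofReal ((1 / (1 + E * (1 + c) * n)) ^ m) := by
    intro c hc
    rw [← hs]; exact lintegral_exp_sum hn γ s (E * (1 + c)) (by positivity)
  set a0 := (1 / (1 + E * n)) ^ m with ha0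
  set a1 := (1 / (1 + E * (1 + θ) * n)) ^ m with ha1
  set a2 := (1 / (1 + E * (1 + 2 * θ) * n)) ^ m with ha2
  have k0 : ∫⁻ ω, ENNReal.ofReal (Real.exp (-(E * Sf ω))) ∂(P n) = ENNReal.ofReal a0 := by
    have := key 0 le_rfl
    simpa [ha0] using this
  have k1 := key θ hθ0
  have k2 := key (2 * θ) (by linarith)
  have hid : (∫⁻ ω, ENNReal.ofReal (Real.exp (-(E * Sf ω)) *
        (6 - Real.exp (-(θ * (E * Sf ω - m)))) ^ 2) ∂(P n))
        + ENNReal.ofReal (12 * Real.exp (θ * m)) * ENNReal.ofReal a1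
      = ENNReal.ofReal 36 * ENNReal.ofReal a0
        + ENNReal.ofReal (Real.exp (2 * θ * m)) * ENNReal.ofReal a2 := by
    rw [← k0, ← k1, ← k2, ← lintegral_const_mul _ (by fun_prop), ← lintegral_const_mul _ (by fun_prop),
      ← lintegral_const_mul _ (by fun_prop), ← lintegral_add_right _ (by fun_prop),
      ← lintegral_add_right _ (by fun_prop)]
    congr 1
    funext ω
    rw [← ENNReal.ofReal_mul (by positivity), ← ENNReal.ofReal_mul (by positivity),
      ← ENNReal.ofReal_mul (by positivity), ← ENNReal.ofReal_add (by positivity) (by positivity),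
      ← ENNReal.ofReal_add (by positivity) (by positivity)]
    congr 1
    generalize Sf ω = x
    have e1 : Real.exp (-(E * (1 + θ) * x)) = Real.exp (-(E * x)) * Real.exp (-(θ * (E * x - m))) * Real.exp (-(θ * m)) := by
      rw [← Real.exp_add, ← Real.exp_add]; congr 1; ring
    have e2 : Real.exp (-(E * (1 + 2 * θ) * x)) = Real.exp (-(E * x)) * Real.exp (-(θ * (E * x - m))) ^ 2 * Real.exp (-(2 * θ * m)) := by
      rw [← Real.exp_nat_mul, ← Real.exp_add, ← Real.exp_add]; congr 1; push_cast; ring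
    have e3 : Real.exp (θ * m) * Real.exp (-(θ * m)) = 1 := by rw [← Real.exp_add]; simp
    have e4 : Real.exp (2 * θ * m) * Real.exp (-(2 * θ * m)) = 1 := by rw [← Real.exp_add]; simp
    rw [e1, e2]
    generalize Real.exp (-(E * x)) = u at *
    generalize Real.exp (-(θ * (E * x - m))) = z at *
    linear_combination (12 * u * z) * e3 - (u * z ^ 2) * e4
  have hnum := block_num n m hn hm hmn θ hθ
  have : ∫⁻ ω, ENNReal.ofReal (Real.exp (-(E * Sf ω)) *
        (6 - Real.exp (-(θ * (E * Sf ω - m)))) ^ 2) ∂(P n)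
      = ENNReal.ofReal 36 * ENNReal.ofReal a0
        + ENNReal.ofReal (Real.exp (2 * θ * m)) * ENNReal.ofReal a2
        - ENNReal.ofReal (12 * Real.exp (θ * m)) * ENNReal.ofReal a1 := by
    rw [← hid, ENNReal.add_sub_cancel_right]
    exact ENNReal.mul_ne_top ENNReal.ofReal_ne_top ENNReal.ofReal_ne_top
  change ∫⁻ ω, ENNReal.ofReal (Real.exp (-(E * Sf ω)) *
        (6 - Real.exp (-(θ * (E * Sf ω - m)))) ^ 2) ∂(P n) ≤ _
  rw [this, ← ENNReal.ofReal_mul (by positivity), ← ENNReal.ofReal_mul (by positivity),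
      ← ENNReal.ofReal_mul (by positivity), ← ENNReal.ofReal_add (by positivity) (by positivity),
      ← ENNReal.ofReal_sub _ (by positivity)]
  apply ENNReal.ofReal_le_ofReal
  linarith

end

section
/-- the `b`-th block of `m` consecutive indices -/
def blk (ℓ m b : ℕ) : Finset (Fin ℓ) := univ.filter fun i => (i:ℕ) / m = b

lemma sum_blk_eq {ℓ m b : ℕ} (hm : 0 < m) (hb : b < ℓ / m) (f : Fin ℓ → ℝ) :
    ∑ i ∈ blk ℓ m b, f i
      = ∑ j : Fin m, f ⟨b * m + j, by
          have h1 : (b + 1) * m ≤ ℓ := (Nat.le_div_iff_mul_le hm).1 hb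
          have := j.2
          rw [add_mul, one_mul] at h1; omega⟩ := by
  have h1 : (b + 1) * m ≤ ℓ := (Nat.le_div_iff_mul_le hm).1 hb
  rw [add_mul, one_mul] at h1
  symm
  refine Finset.sum_bij (fun j _ => ⟨b * m + j, by have := j.2; omega⟩) ?_ ?_ ?_ ?_
  · intro j _
    simp only [blk, mem_filter, mem_univ, true_and]
    rw [mul_comm, Nat.mul_add_div hm, Nat.div_eq_of_lt j.2, add_zero]
  · intro i _ j _ hij
    simp only [Fin.mk.injEq] at hij
    ext; omega
  · intro i hi
    simp only [blk, mem_filter, mem_univ, true_and] at hi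
    have h2 := Nat.div_add_mod (i:ℕ) m
    have h3 := Nat.mod_lt (i:ℕ) hm
    refine ⟨⟨(i:ℕ) % m, h3⟩, mem_univ _, ?_⟩
    ext
    simp only
    rw [hi] at h2
    rw [mul_comm]; exact h2
  · intro j _; rfl

lemma card_blk {ℓ m b : ℕ} (hm : 0 < m) (hb : b < ℓ / m) : (blk ℓ m b).card = m := by
  have := sum_blk_eq hm hb (fun _ => (1:ℝ))
  simp at this
  exact_mod_cast this

lemma exists_subpath {n ℓ m b : ℕ} (hm : 0 < m) (hb : b < ℓ / m) (γ : Path n ℓ) :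
    ∃ γ' : Path n m, ∀ ω, weight ω γ' = ∑ i ∈ blk ℓ m b, ω (γ.edge i) := by
  have h1 : (b + 1) * m ≤ ℓ := (Nat.le_div_iff_mul_le hm).1 hb
  rw [add_mul, one_mul] at h1
  refine ⟨⟨fun j => γ.1 ⟨b * m + j, by have := j.2; omega⟩, ?_⟩, ?_⟩
  · intro i j hij
    have := γ.2 hij
    simp only [Fin.mk.injEq] at this
    ext; omega
  · intro ω
    rw [sum_blk_eq hm hb]
    unfold weight
    refine Finset.sum_congr rfl fun j _ => ?_
    rfl

lemma path_bad {n ℓ m : ℕ} (hn : 0 < n) (hm : 1000000 ≤ m) (hmn : 1000 * m ≤ n)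
    (h a : ℝ) (hh : h ≤ 0.02 * Real.sqrt m) (γ : Path n ℓ) :
    P n {ω | Real.exp 1 * weight ω γ ≤ ℓ + a ∧
        ∀ b < ℓ / m, m - h ≤ Real.exp 1 * ∑ i ∈ blk ℓ m b, ω (γ.edge i)}
      ≤ ENNReal.ofReal (Real.exp a * (1 / (n:ℝ)) ^ ℓ * 0.98 ^ (ℓ / m)) := by
  have hn' : (0:ℝ) < n := by exact_mod_cast hn
  have hm0 : 0 < m := by omega
  have hm' : (0:ℝ) < m := by exact_mod_cast hm0
  have hpr := probExp n hn
  set B := ℓ / m with hB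
  set θ := 1 / Real.sqrt m with hθ
  have hθ0 : 0 < θ := by rw [hθ]; positivity
  have hθh : θ * h ≤ 0.02 := by
    rw [hθ, one_div, inv_mul_le_iff₀ (by positivity)]; linarith
  have hE := Real.exp_pos 1
  set E := Real.exp 1 with hEdef
  let Sf : ℕ → (Sym2 (Fin n) → ℝ) → ℝ := fun b ω => ∑ i ∈ blk ℓ m b, ω (γ.edge i)
  have hSf : ∀ b, Measurable (Sf b) := fun b =>
    Finset.measurable_sum _ fun i _ => measurable_pi_apply _
  let g : ℕ → ℝ → ℝ := fun b x => if b < B then (6 - Real.exp (-(θ * (E * x - m)))) ^ 2 else 1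
  have hg : ∀ b, Measurable (g b) := by
    intro b
    by_cases hb : b < B
    · simp only [g, hb, if_true]; fun_prop
    · simp only [g, hb, if_false]; fun_prop
  have hg0 : ∀ b x, 0 ≤ g b x := by
    intro b x
    simp only [g]; split_ifs <;> positivity
  let f : ℕ → (Sym2 (Fin n) → ℝ) → ENNReal := fun b ω =>
    ENNReal.ofReal (Real.exp (-(E * Sf b ω)) * g b (Sf b ω))
  have hf : ∀ b, Measurable (f b) := by
    intro b
    have := hSf b
    have := (hg b).comp (hSf b)
    simp only [Function.comp_def] at this
    simp only [f]
    fun_prop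
  have hmaps : ∀ i ∈ (univ : Finset (Fin ℓ)), (i:ℕ) / m ∈ Finset.range (B + 1) := by
    intro i _
    rw [Finset.mem_range, Nat.lt_succ_iff]
    exact Nat.div_le_div_right i.2.le
  have hsum : ∀ ω, ∑ b ∈ Finset.range (B + 1), Sf b ω = weight ω γ := by
    intro ω
    exact Finset.sum_fiberwise_of_maps_to hmaps _
  have hcard : ∑ b ∈ Finset.range (B + 1), (blk ℓ m b).card = ℓ := by
    have := Finset.card_eq_sum_card_fiberwise hmaps
    simp at this
    exact this.symm
  have hIntg : ∫⁻ ω, ∏ b ∈ Finset.range (B + 1), f b ω ∂(P n)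
      = ∏ b ∈ Finset.range (B + 1), ∫⁻ ω, f b ω ∂(P n) := by
    unfold P
    refine lintegral_prod_dep _ _ f (fun b => {e | ∃ i ∈ blk ℓ m b, e = γ.edge i})
      (fun b _ => hf b) ?_ ?_
    · intro b _ x y hxy
      have : Sf b x = Sf b y := Finset.sum_congr rfl fun i hi => hxy _ ⟨i, hi, rfl⟩
      simp only [f, this]
    · intro j _ k _ hjk
      rw [Set.disjoint_left]
      rintro e ⟨i, hi, rfl⟩ ⟨i', hi', hii⟩
      have := edge_injective γ hii
      subst this
      simp only [blk, mem_filter, mem_univ, true_and] at hi hi'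
      exact hjk (hi.symm.trans hi')
  have hle : ∀ b ∈ Finset.range (B + 1), ∫⁻ ω, f b ω ∂(P n)
      ≤ ENNReal.ofReal ((if b < B then 24 else 1) * (1 / (E * n)) ^ (blk ℓ m b).card) := by
    intro b _
    by_cases hb : b < B
    · have := block_int hn hm hmn θ hθ γ (blk ℓ m b) (card_blk hm0 hb)
      simp only [f, g, hb, if_true]
      rw [card_blk hm0 hb]
      exact this
    · simp only [f, g, hb, if_false, mul_one, one_mul]
      have := lintegral_exp_sum hn γ (blk ℓ m b) E hE.le
      rw [this]
      apply ENNReal.ofReal_le_ofReal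
      apply pow_le_pow_left₀ (by positivity)
      exact one_div_le_one_div_of_le (by positivity) (by linarith)
  have hprodif : ∀ c : ℝ, ∏ b ∈ Finset.range (B + 1), (if b < B then c else 1) = c ^ B := by
    intro c
    rw [Finset.prod_range_succ]
    simp only [lt_irrefl, if_false, mul_one]
    rw [Finset.prod_congr rfl (g := fun _ => c)]
    · simp
    · intro b hb; simp [Finset.mem_range.1 hb]
  have hmF : Measurable fun ω => ENNReal.ofReal (Real.exp (ℓ + a) * (1 / 24.5) ^ B) *
      ∏ b ∈ Finset.range (B + 1), f b ω :=
    (Finset.measurable_prod _ fun b _ => hf b).const_mul _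
  calc P n {ω | E * weight ω γ ≤ ℓ + a ∧
        ∀ b < B, m - h ≤ E * ∑ i ∈ blk ℓ m b, ω (γ.edge i)}
      ≤ P n {ω | 1 ≤ ENNReal.ofReal (Real.exp (ℓ + a) * (1 / 24.5) ^ B) *
          ∏ b ∈ Finset.range (B + 1), f b ω} := by
        refine measure_mono fun ω hω => ?_
        simp only [Set.mem_ofPred_eq] at hω ⊢
        obtain ⟨h1, h2⟩ := hω
        simp only [f]
        rw [← ENNReal.ofReal_prod_of_nonneg
            (fun b _ => mul_nonneg (Real.exp_pos _).le (hg0 _ _)),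
          ← ENNReal.ofReal_mul (by positivity), ENNReal.one_le_ofReal,
          Finset.prod_mul_distrib, ← Real.exp_sum, Finset.sum_neg_distrib, ← Finset.mul_sum, hsum ω]
        have h3 : (24.5:ℝ) ^ B ≤ ∏ b ∈ Finset.range (B + 1), g b (Sf b ω) := by
          rw [← hprodif]
          refine Finset.prod_le_prod ?_ ?_
          · intro b _; split_ifs <;> norm_num
          · intro b _
            by_cases hb : b < B
            · simp only [g, hb, if_true]
              have h4 := h2 b hb
              have h5 : Real.exp (-(θ * (E * Sf b ω - m))) ≤ 1.03 := by
                calc Real.exp (-(θ * (E * Sf b ω - m))) ≤ Real.exp 0.02 := by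
                      apply Real.exp_le_exp.2
                      have : θ * (-h) ≤ θ * (E * Sf b ω - m) := by
                        apply mul_le_mul_of_nonneg_left _ hθ0.le
                        simp only [Sf]; linarith
                      linarith
                  _ ≤ 1.03 := by
                      have := Real.exp_bound' (x := 0.02) (by norm_num) (by norm_num) (n := 2) (by norm_num)
                      norm_num [Finset.sum_range_succ, Nat.factorial] at this ⊢
                      linarith
              have h6 := Real.exp_pos (-(θ * (E * Sf b ω - m)))
              nlinarith
            · simp [g, hb]
        calc (1:ℝ) ≤ Real.exp (ℓ + a - E * weight ω γ) := by
              rw [Real.one_le_exp_iff]; linarith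
          _ = Real.exp (ℓ + a) * (1 / 24.5) ^ B * (Real.exp (-(E * weight ω γ)) * 24.5 ^ B) := by
              have : ((1:ℝ) / 24.5) ^ B * 24.5 ^ B = 1 := by rw [← mul_pow]; norm_num
              calc Real.exp (ℓ + a - E * weight ω γ)
                  = Real.exp (ℓ + a) * Real.exp (-(E * weight ω γ)) * 1 := by
                    rw [← Real.exp_add, mul_one]; congr 1
                _ = _ := by
                  linear_combination (-(Real.exp (ℓ + a) * Real.exp (-(E * weight ω γ)))) * this
          _ ≤ _ := by gcongr
    _ ≤ ∫⁻ ω, ENNReal.ofReal (Real.exp (ℓ + a) * (1 / 24.5) ^ B) *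
          ∏ b ∈ Finset.range (B + 1), f b ω ∂(P n) := by
        simpa using mul_meas_ge_le_lintegral hmF 1
    _ = ENNReal.ofReal (Real.exp (ℓ + a) * (1 / 24.5) ^ B) *
          ∏ b ∈ Finset.range (B + 1), ∫⁻ ω, f b ω ∂(P n) := by
        rw [lintegral_const_mul _ (Finset.measurable_prod _ fun b _ => hf b), hIntg]
    _ ≤ ENNReal.ofReal (Real.exp (ℓ + a) * (1 / 24.5) ^ B) *
          ∏ b ∈ Finset.range (B + 1),
            ENNReal.ofReal ((if b < B then 24 else 1) * (1 / (E * n)) ^ (blk ℓ m b).card) := by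
        gcongr with b hb
        exact hle b hb
    _ = ENNReal.ofReal (Real.exp (ℓ + a) * (1 / 24.5) ^ B * (24 ^ B * (1 / (E * n)) ^ ℓ)) := by
        rw [← ENNReal.ofReal_prod_of_nonneg, ← ENNReal.ofReal_mul (by positivity),
          Finset.prod_mul_distrib, hprodif, Finset.prod_pow_eq_pow_sum, hcard]
        intro b _
        split_ifs <;> positivity
    _ ≤ _ := by
        apply ENNReal.ofReal_le_ofReal
        have h1 : Real.exp (ℓ + a) = Real.exp a * E ^ ℓ := by
          rw [hEdef, ← Real.exp_nat_mul, ← Real.exp_add]; congr 1; ring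
        have h2 : E ^ ℓ * (1 / (E * n)) ^ ℓ = (1 / (n:ℝ)) ^ ℓ := by
          rw [← mul_pow]; congr 1; field_simp
        calc Real.exp (ℓ + a) * (1 / 24.5) ^ B * (24 ^ B * (1 / (E * n)) ^ ℓ)
            = Real.exp a * (E ^ ℓ * (1 / (E * n)) ^ ℓ) * ((1 / 24.5) ^ B * 24 ^ B) := by
              rw [h1]; ring
          _ = Real.exp a * (1 / (n:ℝ)) ^ ℓ * (24 / 24.5) ^ B := by
              rw [h2, ← mul_pow]; norm_num
          _ ≤ _ := by
              gcongr; norm_num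

lemma upper_one {n ℓ m : ℕ} (hn : 0 < n) (hm : 1000000 ≤ m) (hmn : 1000 * m ≤ n)
    (h a : ℝ) (hh : h ≤ 0.02 * Real.sqrt m) :
    P n {ω | ∃ γ : Path n ℓ, Real.exp 1 * weight ω γ ≤ ℓ + a ∧
        ∀ b < ℓ / m, m - h ≤ Real.exp 1 * ∑ i ∈ blk ℓ m b, ω (γ.edge i)}
      ≤ ENNReal.ofReal (n * Real.exp a * 0.98 ^ (ℓ / m)) := by
  have hn' : (0:ℝ) < n := by exact_mod_cast hn
  rw [show {ω | ∃ γ : Path n ℓ, Real.exp 1 * weight ω γ ≤ ℓ + a ∧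
        ∀ b < ℓ / m, m - h ≤ Real.exp 1 * ∑ i ∈ blk ℓ m b, ω (γ.edge i)}
      = ⋃ γ : Path n ℓ, {ω | Real.exp 1 * weight ω γ ≤ ℓ + a ∧
        ∀ b < ℓ / m, m - h ≤ Real.exp 1 * ∑ i ∈ blk ℓ m b, ω (γ.edge i)} from by ext ω; simp]
  refine (measure_iUnion_le _).trans ?_
  rw [tsum_fintype]
  refine (Finset.sum_le_sum fun γ _ => path_bad hn hm hmn h a hh γ).trans ?_
  rw [Finset.sum_const, nsmul_eq_mul, Finset.card_univ]
  calc (Fintype.card (Path n ℓ) : ENNReal) * _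
      ≤ ENNReal.ofReal ((n:ℝ) ^ (ℓ+1)) * _ := by
        gcongr
        rw [← ENNReal.ofReal_natCast]
        apply ENNReal.ofReal_le_ofReal
        exact_mod_cast card_path_le n ℓ
    _ = _ := by
        rw [← ENNReal.ofReal_mul (by positivity)]
        congr 1
        rw [pow_succ, one_div, inv_pow]
        field_simp

/-- upper bound: existence of a long path -/
lemma upper_all {n m ℓ1 : ℕ} (hn : 0 < n) (hm : 1000000 ≤ m) (hmn : 1000 * m ≤ n)
    (h lam : ℝ) (hh : h ≤ 0.02 * Real.sqrt m) (q : ℝ)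
    (hq : ∀ ℓ : ℕ, ℓ1 < ℓ → ℓ < n →
      n * Real.exp (Real.exp 1 * lam * ℓ - ℓ) * 0.98 ^ (ℓ / m) ≤ q) :
    P n {ω | ∃ ℓ : ℕ, ℓ1 < ℓ ∧ ∃ γ : Path n ℓ, weight ω γ ≤ lam * ℓ}
      ≤ ENNReal.ofReal (n * Real.exp (-h)) + n * ENNReal.ofReal q := by
  have hm0 : 0 < m := by omega
  have hsub : {ω | ∃ ℓ : ℕ, ℓ1 < ℓ ∧ ∃ γ : Path n ℓ, weight ω γ ≤ lam * ℓ}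
      ⊆ {ω | ∃ γ : Path n m, Real.exp 1 * weight ω γ ≤ m - h} ∪
        ⋃ ℓ ∈ (Finset.range n).filter (fun ℓ => ℓ1 < ℓ),
          {ω | ∃ γ : Path n ℓ, Real.exp 1 * weight ω γ ≤ ℓ + (Real.exp 1 * lam * ℓ - ℓ) ∧
            ∀ b < ℓ / m, m - h ≤ Real.exp 1 * ∑ i ∈ blk ℓ m b, ω (γ.edge i)} := by
    rintro ω ⟨ℓ, hℓ, γ, hγ⟩
    by_cases hb : ∀ b < ℓ / m, m - h ≤ Real.exp 1 * ∑ i ∈ blk ℓ m b, ω (γ.edge i)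
    · right
      simp only [Set.mem_iUnion]
      refine ⟨ℓ, ?_, γ, ?_, hb⟩
      · have := Fintype.card_le_of_injective _ γ.2
        simp at this
        simp [hℓ]; omega
      · have := mul_le_mul_of_nonneg_left hγ (Real.exp_pos 1).le
        linarith
    · left
      push Not at hb
      obtain ⟨b, hb, hlt⟩ := hb
      obtain ⟨γ', hγ'⟩ := exists_subpath hm0 hb γ
      refine ⟨γ', ?_⟩
      rw [hγ']; exact hlt.le
  refine (measure_mono hsub).trans ((measure_union_le _ _).trans (add_le_add (light_any hn h) ?_))
  refine (measure_biUnion_finset_le _ _).trans ?_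
  calc _ ≤ ∑ ℓ ∈ (Finset.range n).filter (fun ℓ => ℓ1 < ℓ), ENNReal.ofReal q := by
        refine Finset.sum_le_sum fun ℓ hℓ => ?_
        simp at hℓ
        exact (upper_one hn hm hmn h _ hh).trans (ENNReal.ofReal_le_ofReal (hq ℓ hℓ.2 hℓ.1))
    _ ≤ _ := by
        rw [Finset.sum_const, nsmul_eq_mul]
        gcongr
        exact_mod_cast (Finset.card_filter_le _ _).trans (by simp)

end

section
lemma log_tendsto : Tendsto (fun n : ℕ => Real.log n) atTop atTop :=
  Real.tendsto_log_atTop.comp tendsto_natCast_atTop_atTop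

/-- powers of the logarithm are eventually smaller than powers -/
lemma ev_log_pow (a : ℝ) (k : ℕ) (b : ℝ) (hb : 0 < b) :
    ∀ᶠ n : ℕ in atTop, a * Real.log n ^ k ≤ Real.exp (b * Real.log n) := by
  have h1 : Tendsto (fun x : ℝ => x ^ k * Real.exp (-b * x)) atTop (nhds 0) := by
    have := tendsto_rpow_mul_exp_neg_mul_atTop_nhds_zero k b hb
    simpa using this
  have h2 := (h1.const_mul a).comp log_tendsto
  rw [mul_zero] at h2
  filter_upwards [h2.eventually (gt_mem_nhds (zero_lt_one))] with n hn
  simp only [Function.comp_def] at hn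
  have : Real.exp (-b * Real.log n) * Real.exp (b * Real.log n) = 1 := by
    rw [← Real.exp_add]; simp
  have h3 := Real.exp_pos (b * Real.log n)
  nlinarith

lemma upper_final : ∀ᶠ n : ℕ in atTop,
    P n {ω | ∃ ℓ : ℕ, 10 ^ 7 * Real.log n ^ 3 < ℓ ∧ ∃ γ : Path n ℓ,
        weight ω γ ≤ (Real.exp (-1) + 1 / 10 ^ 7 * (Real.log n ^ 2)⁻¹) * ℓ}
      ≤ ENNReal.ofReal (3 / n) := by
  filter_upwards [log_tendsto.eventually_ge_atTop 100, ev_log_pow (20000 * 1000) 2 1 one_pos,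
    eventually_ge_atTop 2] with n hL hpow hn2
  have hn : 0 < n := by omega
  have hn' : (0:ℝ) < n := by exact_mod_cast hn
  have hn2' : (2:ℝ) ≤ n := by exact_mod_cast hn2
  rw [one_mul, Real.exp_log hn'] at hpow
  have hexp : Real.exp (-Real.log n) = 1 / n := by
    rw [Real.exp_neg, Real.exp_log hn', one_div]
  set L := Real.log n with hLdef
  set m := ⌈10000 * L ^ 2⌉₊ with hm
  have hL0 : 0 < L := by linarith
  have hm1 : 10000 * L ^ 2 ≤ m := Nat.le_ceil _
  have hm2 : (m:ℝ) ≤ 20000 * L ^ 2 := by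
    have := Nat.ceil_lt_add_one (a := 10000 * L ^ 2) (by positivity)
    nlinarith
  have hm3 : 1000000 ≤ m := by
    have : (1000000:ℝ) ≤ m := by nlinarith
    exact_mod_cast this
  have hm4 : 1000 * m ≤ n := by
    have : (1000:ℝ) * m ≤ n := by nlinarith
    exact_mod_cast this
  have hm0 : (0:ℝ) < m := by nlinarith
  have hh : 2 * L ≤ 0.02 * Real.sqrt m := by
    have : 100 * L ≤ Real.sqrt m := by
      rw [Real.le_sqrt (by positivity) (by positivity)]; nlinarith
    linarith
  set lam := Real.exp (-1) + 1 / 10 ^ 7 * (L ^ 2)⁻¹ with hlam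
  have hE3 : Real.exp 1 ≤ 3 := by have := Real.exp_one_lt_d9; linarith
  have hEE : Real.exp 1 * Real.exp (-1) = 1 := by rw [← Real.exp_add]; simp
  have hset : {ω : Sym2 (Fin n) → ℝ | ∃ ℓ : ℕ, 10 ^ 7 * L ^ 3 < ℓ ∧ ∃ γ : Path n ℓ, weight ω γ ≤ lam * ℓ}
      = {ω | ∃ ℓ : ℕ, ⌊10 ^ 7 * L ^ 3⌋₊ < ℓ ∧ ∃ γ : Path n ℓ, weight ω γ ≤ lam * ℓ} := by
    ext ω
    simp only [Set.mem_ofPred_eq]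
    refine exists_congr fun ℓ => and_congr_left fun _ => ?_
    rw [Nat.floor_lt (by positivity)]
  rw [hset]
  refine (upper_all hn hm3 hm4 (2 * L) lam hh (2 * (1 / n) ^ 4) ?_).trans ?_
  · intro ℓ h1 _
    rw [Nat.floor_lt (by positivity)] at h1
    have hx : Real.exp 1 * lam * ℓ - ℓ ≤ 3 / 10 ^ 7 * (ℓ / L ^ 2) := by
      have : Real.exp 1 * lam * ℓ - ℓ = Real.exp 1 * (1 / 10 ^ 7 * (ℓ / L ^ 2)) := by
        rw [hlam]
        calc _ = (Real.exp 1 * Real.exp (-1)) * ℓ - ℓ + Real.exp 1 * (1 / 10 ^ 7 * (ℓ / L ^ 2)) := by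
              rw [div_eq_mul_inv (ℓ:ℝ)]; ring
          _ = _ := by rw [hEE]; ring
      rw [this]
      have h0 : 0 ≤ (ℓ:ℝ) / L ^ 2 := by positivity
      nlinarith
    have hy : (0.98:ℝ) ^ (ℓ / m) ≤ Real.exp (0.02 - 10 / 10 ^ 7 * (ℓ / L ^ 2)) := by
      calc (0.98:ℝ) ^ (ℓ / m) ≤ (Real.exp (-0.02)) ^ (ℓ / m) := by
            apply pow_le_pow_left₀ (by norm_num)
            have := Real.add_one_le_exp (-0.02 : ℝ)
            norm_num at this ⊢; linarith
        _ = Real.exp (-0.02 * (ℓ / m : ℕ)) := by rw [← Real.exp_nat_mul]; ring_nf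
        _ ≤ _ := by
            apply Real.exp_le_exp.2
            have h2 : (ℓ:ℝ) / m < (ℓ / m : ℕ) + 1 := by
              rw [← Nat.floor_div_eq_div (K := ℝ)]
              exact Nat.lt_floor_add_one _
            have h3 : (ℓ:ℝ) / (20000 * L ^ 2) ≤ ℓ / m := by
              gcongr
            have h4 : (ℓ:ℝ) / (20000 * L ^ 2) = 1 / 20000 * (ℓ / L ^ 2) := by
              field_simp
            rw [h4] at h3
            linarith
    have hz : 10 ^ 7 * L ≤ ℓ / L ^ 2 := by
      rw [le_div_iff₀ (by positivity)]; nlinarith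
    calc n * Real.exp (Real.exp 1 * lam * ℓ - ℓ) * 0.98 ^ (ℓ / m)
        ≤ n * Real.exp (3 / 10 ^ 7 * (ℓ / L ^ 2)) * Real.exp (0.02 - 10 / 10 ^ 7 * (ℓ / L ^ 2)) := by
          gcongr
      _ = n * Real.exp (0.02 - 7 / 10 ^ 7 * (ℓ / L ^ 2)) := by
          rw [mul_assoc, ← Real.exp_add]; congr 2; ring
      _ ≤ n * Real.exp (0.02 + (5:ℕ) * (-L)) := by
          gcongr; push_cast; linarith
      _ = Real.exp 0.02 * (n * (1 / n) ^ 5) := by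
          rw [Real.exp_add, Real.exp_nat_mul, hexp]; ring
      _ ≤ 2 * (n * (1 / n) ^ 5) := by
          gcongr
          have := Real.exp_bound' (x := 0.02) (by norm_num) (by norm_num) (n := 2) (by norm_num)
          norm_num [Finset.sum_range_succ, Nat.factorial] at this ⊢
          linarith
      _ = 2 * (1 / n) ^ 4 := by field_simp
  · rw [← ENNReal.ofReal_natCast, ← ENNReal.ofReal_mul (by positivity),
      ← ENNReal.ofReal_add (by positivity) (by positivity)]
    apply ENNReal.ofReal_le_ofReal
    have h1 : Real.exp (-(2 * L)) = (1 / n) ^ 2 := by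
      rw [← hexp, ← Real.exp_nat_mul]; congr 1; push_cast; ring
    rw [h1]
    have h2 : (n:ℝ) * (1 / n) ^ 2 + n * (2 * (1 / n) ^ 4) = 1 / n + 2 * (1 / n) ^ 3 := by field_simp
    rw [h2]
    have h3 : 1 / (n:ℝ) ≤ 1 := by rw [div_le_one hn']; linarith
    have h4 : 0 < 1 / (n:ℝ) := by positivity
    have h5 : (1 / (n:ℝ)) ^ 3 ≤ 1 / n := by
      calc (1 / (n:ℝ)) ^ 3 ≤ (1 / (n:ℝ)) ^ 1 := pow_le_pow_of_le_one h4.le h3 (by norm_num)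
        _ = _ := pow_one _
    have h6 : 3 / (n:ℝ) = 3 * (1 / n) := by ring
    rw [h6]; linarith

end

section
open Classical in
/-- weight of a single step of the walk -/
noncomputable def stepW {n : ℕ} (y : Fin n → Fin n → ℝ) (Sh : Fin n → Fin n → Prop) (ρ : ℝ)
    (u v x : Fin n) : ℝ :=
  if x ≠ u then y v x * (if Sh v x ∧ ¬ Sh u v then ρ else 1) else 0

/-- weighted count of non-backtracking walks -/
noncomputable def walkW {n : ℕ} (y : Fin n → Fin n → ℝ) (Sh : Fin n → Fin n → Prop) (ρ : ℝ) :
    ℕ → Fin n → Fin n → ℝ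
  | 0, _, _ => 1
  | r + 1, u, v => ∑ x, stepW y Sh ρ u v x * walkW y Sh ρ r v x

/-- weight of one walk -/
noncomputable def seqW {n : ℕ} (y : Fin n → Fin n → ℝ) (Sh : Fin n → Fin n → Prop) (ρ : ℝ) :
    (r : ℕ) → Fin n → Fin n → (Fin r → Fin n) → ℝ
  | 0, _, _, _ => 1
  | r + 1, u, v, x => stepW y Sh ρ u v (x 0) * seqW y Sh ρ r v (x 0) (Fin.tail x)

lemma walkW_eq {n : ℕ} (y : Fin n → Fin n → ℝ) (Sh : Fin n → Fin n → Prop) (ρ : ℝ) (r : ℕ) :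
    ∀ u v, walkW y Sh ρ r u v = ∑ x : Fin r → Fin n, seqW y Sh ρ r u v x := by
  induction r with
  | zero => intro u v; simp [walkW, seqW]
  | succ r ih =>
    intro u v
    rw [← (Fin.consEquiv fun _ : Fin (r+1) => Fin n).sum_comp, Fintype.sum_prod_type]
    simp only [walkW, ih, Finset.mul_sum]
    refine Finset.sum_congr rfl fun a _ => Finset.sum_congr rfl fun x _ => ?_
    simp [seqW, Fin.consEquiv]

lemma stepW_nonneg {n : ℕ} {y : Fin n → Fin n → ℝ} {Sh : Fin n → Fin n → Prop} {ρ : ℝ}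
    (hy : ∀ a b, 0 ≤ y a b) (hρ : 1 ≤ ρ) (u v x : Fin n) : 0 ≤ stepW y Sh ρ u v x := by
  unfold stepW
  split_ifs
  · exact mul_nonneg (hy _ _) (by linarith)
  · exact mul_nonneg (hy _ _) (by linarith)
  · exact le_rfl

lemma stepW_le {n : ℕ} {y : Fin n → Fin n → ℝ} {Sh : Fin n → Fin n → Prop} {ρ : ℝ}
    (hy : ∀ a b, 0 ≤ y a b) (u v x : Fin n) (h : ¬ (Sh v x ∧ ¬ Sh u v)) :
    stepW y Sh ρ u v x ≤ y v x := by
  unfold stepW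
  by_cases hx : x ≠ u
  · rw [if_pos hx, if_neg h, mul_one]
  · rw [if_neg hx]; exact hy _ _

lemma seqW_nonneg {n : ℕ} {y : Fin n → Fin n → ℝ} {Sh : Fin n → Fin n → Prop} {ρ : ℝ}
    (hy : ∀ a b, 0 ≤ y a b) (hρ : 1 ≤ ρ) (r : ℕ) : ∀ u v x, 0 ≤ seqW y Sh ρ r u v x := by
  induction r with
  | zero => intro u v x; simp [seqW]
  | succ r ih => intro u v x; exact mul_nonneg (stepW_nonneg hy hρ _ _ _) (ih _ _ _)

lemma seqW_ge {n : ℕ} {y : Fin n → Fin n → ℝ} {Sh : Fin n → Fin n → Prop} {ρ : ℝ}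
    (hy : ∀ a b, 0 ≤ y a b) (hρ : 1 ≤ ρ) (r : ℕ) :
    ∀ (u : Fin n) (g : Fin (r + 1) → Fin n), Function.Injective g → (∀ j : Fin r, g j.succ ≠ u) →
      (∏ i : Fin r, y (g i.castSucc) (g i.succ)) ≤ seqW y Sh ρ r u (g 0) (Fin.tail g) ∧
      (¬ Sh u (g 0) → (∃ i : Fin r, Sh (g i.castSucc) (g i.succ)) →
        ρ * (∏ i : Fin r, y (g i.castSucc) (g i.succ)) ≤ seqW y Sh ρ r u (g 0) (Fin.tail g)) := by
  induction r with
  | zero =>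
    intro u g _ _
    refine ⟨by simp [seqW], ?_⟩
    rintro _ ⟨i, _⟩; exact i.elim0
  | succ r ih =>
    intro u g hg hu
    have hu0 : g (Fin.succ 0) ≠ u := hu 0
    have htail : Function.Injective (Fin.tail g) := fun i j h => Fin.succ_injective _ (hg h)
    obtain ⟨h1, h2⟩ := ih (g 0) (Fin.tail g) htail (fun j h => by
      have := hg h
      exact absurd this (Fin.succ_ne_zero _))
    have hstep : y (g 0) (g (Fin.succ 0)) ≤ stepW y Sh ρ u (g 0) (Fin.tail g 0) := by
      unfold stepW
      rw [if_pos (show Fin.tail g 0 ≠ u from hu0)]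
      have := hy (g 0) (g (Fin.succ 0))
      change _ ≤ y (g 0) (g (Fin.succ 0)) * _
      split_ifs <;> nlinarith
    have hprod : ∏ i : Fin (r+1), y (g i.castSucc) (g i.succ)
        = y (g 0) (g (Fin.succ 0)) * ∏ i : Fin r, y (Fin.tail g i.castSucc) (Fin.tail g i.succ) := by
      rw [Fin.prod_univ_succ]; rfl
    have hP : 0 ≤ ∏ i : Fin r, y (Fin.tail g i.castSucc) (Fin.tail g i.succ) :=
      Finset.prod_nonneg fun i _ => hy _ _
    rw [hprod]
    have hy0 := hy (g 0) (g (Fin.succ 0))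
    refine ⟨?_, ?_⟩
    · exact mul_le_mul hstep h1 hP (stepW_nonneg hy hρ _ _ _)
    · intro hns hex
      by_cases hs : Sh (g 0) (g (Fin.succ 0))
      · have hstep2 : ρ * y (g 0) (g (Fin.succ 0)) ≤ stepW y Sh ρ u (g 0) (Fin.tail g 0) := by
          unfold stepW
          rw [if_pos (show Fin.tail g 0 ≠ u from hu0), if_pos ⟨hs, hns⟩]
          change _ ≤ y (g 0) (g (Fin.succ 0)) * ρ
          linarith
        rw [← mul_assoc]
        exact mul_le_mul hstep2 h1 hP (stepW_nonneg hy hρ _ _ _)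
      · have h3 : ∃ i : Fin r, Sh (Fin.tail g i.castSucc) (Fin.tail g i.succ) := by
          obtain ⟨i, hi⟩ := hex
          rcases Fin.eq_zero_or_eq_succ i with rfl | ⟨j, rfl⟩
          · exact absurd hi hs
          · exact ⟨j, hi⟩
        have h4 := h2 hs h3
        calc ρ * (y (g 0) (g (Fin.succ 0)) * ∏ i : Fin r, y (Fin.tail g i.castSucc) (Fin.tail g i.succ))
            = y (g 0) (g (Fin.succ 0)) * (ρ * ∏ i : Fin r, y (Fin.tail g i.castSucc) (Fin.tail g i.succ)) := by ring
          _ ≤ _ := mul_le_mul hstep h4 (mul_nonneg (by linarith) hP) (stepW_nonneg hy hρ _ _ _)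

/-- hypotheses on the step weights relative to the reference path `v`. -/
structure StepHyp (n ℓ : ℕ) (v : ℕ → Fin n) (φ : ℕ → ℝ) (Rl Rh : ℝ) (y : Fin n → Fin n → ℝ)
    (Sh : Fin n → Fin n → Prop) : Prop where
  npos : 0 < n
  inj : ∀ i j, i ≤ ℓ → j ≤ ℓ → v i = v j → i = j
  ynn : ∀ a b, 0 ≤ y a b
  yns : ∀ a b, ¬ Sh a b → y a b ≤ 1 / n
  sh : ∀ a b, Sh a b → ∃ i < ℓ, (a = v i ∧ b = v (i + 1)) ∨ (a = v (i + 1) ∧ b = v i)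
  yR : ∀ i < ℓ, y (v i) (v (i + 1)) = φ (i + 1) / φ i
  yL : ∀ i < ℓ, y (v (i + 1)) (v i) = φ (i + 1) / φ i
  shR : ∀ i < ℓ, Sh (v i) (v (i + 1))
  shL : ∀ i < ℓ, Sh (v (i + 1)) (v i)
  Rl0 : 0 < Rl
  lo : ∀ i ≤ ℓ, Rl ≤ φ i
  hi : ∀ i ≤ ℓ, φ i ≤ Rh

lemma walkW_bound {n ℓ : ℕ} {v : ℕ → Fin n} {φ : ℕ → ℝ} {Rl Rh : ℝ} {y : Fin n → Fin n → ℝ}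
    {Sh : Fin n → Fin n → Prop} (H : StepHyp n ℓ v φ Rl Rh y Sh) (ρ : ℝ) (hρ : 1 ≤ ρ)
    (b β : ℝ) (hb : b = 1 + 2 * ρ * (ℓ + 1) * (Rh / Rl)) (hβ : β = (ℓ + 1) * b / n) (r : ℕ)
    (hr : r ≤ ℓ) :
    (∀ u x, (∀ i ≤ ℓ, x ≠ v i) → walkW y Sh ρ r u x ≤ (1 + β) ^ r) ∧
    (∀ u, ∀ i ≤ ℓ, ¬ Sh u (v i) → walkW y Sh ρ r u (v i) ≤ (1 + β) ^ r * b) ∧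
    (∀ i < ℓ, walkW y Sh ρ r (v i) (v (i + 1)) ≤ (1 + β) ^ r * (r + 1) * (Rh / φ (i + 1))) ∧
    (∀ i < ℓ, walkW y Sh ρ r (v (i + 1)) (v i) ≤ (1 + β) ^ r * (r + 1) * (φ i / Rl)) := by
  classical
  have hn' : (0:ℝ) < n := by exact_mod_cast H.npos
  have hRl := H.Rl0
  have hRh : Rl ≤ Rh := (H.lo 0 (by omega)).trans (H.hi 0 (by omega))
  have hR1 : 1 ≤ Rh / Rl := by rw [le_div_iff₀ hRl]; linarith
  have hφ : ∀ i ≤ ℓ, 0 < φ i := fun i hi => hRl.trans_le (H.lo i hi)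
  have hb1 : 1 ≤ b := by
    rw [hb]; have : 0 ≤ 2 * ρ * (ℓ + 1) * (Rh / Rl) := by positivity
    linarith
  have hβ0 : 0 ≤ β := by rw [hβ]; positivity
  have hhi : ∀ i ≤ ℓ, 1 ≤ Rh / φ i := fun i hi => by
    rw [le_div_iff₀ (hφ i hi)]; linarith [H.hi i hi]
  have hlo : ∀ i ≤ ℓ, 1 ≤ φ i / Rl := fun i hi => by
    rw [le_div_iff₀ hRl]; linarith [H.lo i hi]
  have hhi2 : ∀ i ≤ ℓ, Rh / φ i ≤ Rh / Rl := fun i hi =>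
    div_le_div_of_nonneg_left (by linarith) hRl (H.lo i hi)
  have hlo2 : ∀ i ≤ ℓ, φ i / Rl ≤ Rh / Rl := fun i hi =>
    div_le_div_of_nonneg_right (H.hi i hi) hRl.le
  induction r with
  | zero =>
    refine ⟨fun u x _ => by simp [walkW], fun u i _ _ => by simpa [walkW] using hb1,
      fun i hi => by simpa [walkW] using hhi (i+1) hi, fun i hi => by simpa [walkW] using hlo i hi.le⟩
  | succ r ih =>
    obtain ⟨iO, iI, iR, iL⟩ := ih (by omega)
    have hW0 : ∀ r u v, 0 ≤ walkW y Sh ρ r u v := by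
      intro r u v; rw [walkW_eq]; exact Finset.sum_nonneg fun x _ => seqW_nonneg H.ynn hρ _ _ _ _
    set a := (1 + β) ^ r with ha
    have ha0 : 0 < a := by positivity
    have ha1 : (1 + β) ^ (r + 1) = a * (1 + β) := pow_succ _ _
    rw [ha1]
    have haa : a ≤ a * (1 + β) := by nlinarith
    -- nonshared contribution
    have hns : ∀ z : Fin n, ∑ x, (if Sh z x then 0 else y z x * walkW y Sh ρ r z x) ≤ a * (1 + β) := by
      intro z
      have hterm : ∀ x, (if Sh z x then 0 else y z x * walkW y Sh ρ r z x)
          ≤ 1 / n * (a + ∑ i ∈ Finset.range (ℓ + 1), if x = v i then a * b else 0) := by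
        intro x
        have hnn : 0 ≤ ∑ i ∈ Finset.range (ℓ + 1), (if x = v i then a * b else 0) :=
          Finset.sum_nonneg fun i _ => by split_ifs <;> positivity
        by_cases hs : Sh z x
        · rw [if_pos hs]; positivity
        · rw [if_neg hs]
          refine mul_le_mul (H.yns _ _ hs) ?_ (hW0 _ _ _) (by positivity)
          by_cases hx : ∀ i ≤ ℓ, x ≠ v i
          · exact (iO z x hx).trans (by linarith)
          · push Not at hx
            obtain ⟨i, hi, rfl⟩ := hx
            refine (iI z i hi hs).trans ?_
            have : a * b ≤ ∑ j ∈ Finset.range (ℓ + 1), (if v i = v j then a * b else 0) := by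
              refine le_trans ?_ (Finset.single_le_sum (f := fun j => if v i = v j then a * b else 0)
                (fun j _ => by split_ifs <;> positivity) (Finset.mem_range.2 (Nat.lt_succ_of_le hi)))
              simp
            linarith
      refine (Finset.sum_le_sum fun x _ => hterm x).trans ?_
      rw [← Finset.mul_sum, Finset.sum_add_distrib, Finset.sum_comm]
      simp only [Finset.sum_ite_eq', Finset.mem_univ, if_true, Finset.sum_const, Finset.card_univ,
        Fintype.card_fin, Finset.card_range, nsmul_eq_mul]
      rw [hβ]
      apply le_of_eq
      push_cast
      field_simp
    -- right and left moves
    have hTR : ∀ i < ℓ, y (v i) (v (i + 1)) * walkW y Sh ρ r (v i) (v (i + 1))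
        ≤ a * (r + 1) * (Rh / φ i) := by
      intro i hi
      have h1 := hφ i hi.le
      have h2 := hφ (i + 1) hi
      rw [H.yR i hi]
      calc φ (i + 1) / φ i * walkW y Sh ρ r (v i) (v (i + 1))
          ≤ φ (i + 1) / φ i * (a * (r + 1) * (Rh / φ (i + 1))) := by
            apply mul_le_mul_of_nonneg_left (iR i hi) (by positivity)
        _ = _ := by field_simp
    have hTL : ∀ i < ℓ, y (v (i + 1)) (v i) * walkW y Sh ρ r (v (i + 1)) (v i)
        ≤ a * (r + 1) * (φ (i + 1) / Rl) := by
      intro i hi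
      have h1 := hφ i hi.le
      have h2 := hφ (i + 1) hi
      rw [H.yL i hi]
      calc φ (i + 1) / φ i * walkW y Sh ρ r (v (i + 1)) (v i)
          ≤ φ (i + 1) / φ i * (a * (r + 1) * (φ i / Rl)) := by
            apply mul_le_mul_of_nonneg_left (iL i hi) (by positivity)
        _ = _ := by field_simp
    -- one-step decomposition
    have hdec : ∀ (u : Fin n) (i : ℕ), i ≤ ℓ → ∀ (cR cL : ℝ), 0 ≤ cR → 0 ≤ cL →
        (i < ℓ → stepW y Sh ρ u (v i) (v (i + 1)) * walkW y Sh ρ r (v i) (v (i + 1)) ≤ cR) →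
        (∀ j, i = j + 1 → stepW y Sh ρ u (v i) (v j) * walkW y Sh ρ r (v i) (v j) ≤ cL) →
        walkW y Sh ρ (r + 1) u (v i) ≤ a * (1 + β) + cR + cL := by
      intro u i hi cR cL hcR hcL hR hL
      simp only [walkW]
      have hterm : ∀ x, stepW y Sh ρ u (v i) x * walkW y Sh ρ r (v i) x
          ≤ (if Sh (v i) x then 0 else y (v i) x * walkW y Sh ρ r (v i) x)
            + (if x = v (i + 1) then cR else 0) + (if x = v (i - 1) then cL else 0) := by
        intro x
        have e1 : 0 ≤ (if x = v (i + 1) then cR else 0) := by split_ifs <;> linarith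
        have e2 : 0 ≤ (if x = v (i - 1) then cL else 0) := by split_ifs <;> linarith
        by_cases hs : Sh (v i) x
        · rw [if_pos hs]
          obtain ⟨j, hj, ⟨h1, h2⟩ | ⟨h1, h2⟩⟩ := H.sh _ _ hs
          · have := H.inj i j hi hj.le h1
            subst this
            subst h2
            have := hR hj
            simp only [if_true] at e1 ⊢; linarith
          · have := H.inj i (j + 1) hi hj h1
            subst this
            subst h2
            have := hL j rfl
            simp only [Nat.add_sub_cancel, if_true] at e2 ⊢; linarith
        · rw [if_neg hs]
          have : stepW y Sh ρ u (v i) x ≤ y (v i) x := by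
            exact stepW_le H.ynn _ _ _ (fun h => hs h.1)
          have := mul_le_mul_of_nonneg_right this (hW0 r (v i) x)
          linarith
      refine (Finset.sum_le_sum fun x _ => hterm x).trans ?_
      rw [Finset.sum_add_distrib, Finset.sum_add_distrib]
      simp only [Finset.sum_ite_eq', Finset.mem_univ, if_true]
      linarith [hns (v i)]
    have hstepS : ∀ u z x, Sh u z → stepW y Sh ρ u z x ≤ y z x := by
      intro u z x hs
      exact stepW_le H.ynn _ _ _ (fun h => h.2 hs)
    have hstepρ : ∀ u z x, stepW y Sh ρ u z x ≤ ρ * y z x := by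
      intro u z x
      have := H.ynn z x
      unfold stepW
      split_ifs <;> nlinarith
    have hrr : (0:ℝ) ≤ r := Nat.cast_nonneg r
    refine ⟨?_, ?_, ?_, ?_⟩
    · intro u x hx
      simp only [walkW]
      refine le_trans (Finset.sum_le_sum fun z _ => ?_) (hns x)
      have hs : ¬ Sh x z := by
        intro hs
        obtain ⟨i, hi, ⟨h1, _⟩ | ⟨h1, _⟩⟩ := H.sh _ _ hs
        · exact hx i hi.le h1
        · exact hx (i+1) hi h1
      rw [if_neg hs]
      refine mul_le_mul_of_nonneg_right ?_ (hW0 _ _ _)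
      exact stepW_le H.ynn _ _ _ (fun h => hs h.1)
    · intro u i hi _
      have hc : 0 ≤ ρ * (a * (r + 1) * (Rh / Rl)) := by positivity
      refine (hdec u i hi _ _ hc hc ?_ ?_).trans ?_
      · intro hil
        calc stepW y Sh ρ u (v i) (v (i + 1)) * walkW y Sh ρ r (v i) (v (i + 1))
            ≤ ρ * y (v i) (v (i + 1)) * walkW y Sh ρ r (v i) (v (i + 1)) :=
              mul_le_mul_of_nonneg_right (hstepρ _ _ _) (hW0 _ _ _)
          _ = ρ * (y (v i) (v (i + 1)) * walkW y Sh ρ r (v i) (v (i + 1))) := by ring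
          _ ≤ _ := by
            refine mul_le_mul_of_nonneg_left ((hTR i hil).trans ?_) (by linarith)
            exact mul_le_mul_of_nonneg_left (hhi2 i hi) (by positivity)
      · rintro j rfl
        calc stepW y Sh ρ u (v (j + 1)) (v j) * walkW y Sh ρ r (v (j + 1)) (v j)
            ≤ ρ * y (v (j + 1)) (v j) * walkW y Sh ρ r (v (j + 1)) (v j) :=
              mul_le_mul_of_nonneg_right (hstepρ _ _ _) (hW0 _ _ _)
          _ = ρ * (y (v (j + 1)) (v j) * walkW y Sh ρ r (v (j + 1)) (v j)) := by ring
          _ ≤ _ := by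
            refine mul_le_mul_of_nonneg_left ((hTL j hi).trans ?_) (by linarith)
            exact mul_le_mul_of_nonneg_left (hlo2 _ hi) (by positivity)
      · have hrl : (r:ℝ) + 1 ≤ ℓ + 1 := by
          have : (r:ℝ) ≤ ℓ := by exact_mod_cast (by omega : r ≤ ℓ)
          linarith
        have h5 : ρ * (a * (r + 1) * (Rh / Rl)) ≤ ρ * (a * (1 + β) * (ℓ + 1) * (Rh / Rl)) := by
          gcongr
        calc a * (1 + β) + ρ * (a * (r + 1) * (Rh / Rl)) + ρ * (a * (r + 1) * (Rh / Rl))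
            ≤ a * (1 + β) + ρ * (a * (1 + β) * (ℓ + 1) * (Rh / Rl))
              + ρ * (a * (1 + β) * (ℓ + 1) * (Rh / Rl)) := by linarith
          _ = a * (1 + β) * b := by rw [hb]; ring
    · intro i hi
      have h1 := hhi (i + 1) hi
      have hc : 0 ≤ a * (r + 1) * (Rh / φ (i + 1)) := by positivity
      refine (hdec (v i) (i + 1) hi _ 0 hc le_rfl ?_ ?_).trans ?_
      · intro hil
        refine le_trans ?_ (hTR (i + 1) hil)
        exact mul_le_mul_of_nonneg_right (hstepS _ _ _ (H.shR i hi)) (hW0 _ _ _)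
      · intro j hj
        have : i = j := by omega
        subst this
        simp [stepW]
      · push_cast
        have h5 : a * (r + 1) * (Rh / φ (i + 1)) ≤ a * (1 + β) * (r + 1) * (Rh / φ (i + 1)) := by
          gcongr
        have h6 : a * (1 + β) ≤ a * (1 + β) * (Rh / φ (i + 1)) := le_mul_of_one_le_right (by positivity) h1
        linarith
    · intro i hi
      have h1 := hlo i hi.le
      have hc : 0 ≤ a * (r + 1) * (φ i / Rl) := by positivity
      refine (hdec (v (i + 1)) i hi.le 0 _ le_rfl hc ?_ ?_).trans ?_
      · intro _; simp [stepW]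
      · rintro j rfl
        refine le_trans ?_ (hTL j (by omega))
        exact mul_le_mul_of_nonneg_right (hstepS _ _ _ (H.shL _ hi)) (hW0 _ _ _)
      · push_cast
        have h5 : a * (r + 1) * (φ i / Rl) ≤ a * (1 + β) * (r + 1) * (φ i / Rl) := by
          gcongr
        have h6 : a * (1 + β) ≤ a * (1 + β) * (φ i / Rl) := le_mul_of_one_le_right (by positivity) h1
        linarith

end

section
lemma walk_total {n ℓ : ℕ} {v : ℕ → Fin n} {φ : ℕ → ℝ} {Rl Rh : ℝ} {y : Fin n → Fin n → ℝ}
    {Sh : Fin n → Fin n → Prop} (H : StepHyp n ℓ v φ Rl Rh y Sh) (ρ : ℝ) (hρ : 1 ≤ ρ)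
    (b β : ℝ) (hb : b = 1 + 2 * ρ * (ℓ + 1) * (Rh / Rl)) (hβ : β = (ℓ + 1) * b / n) :
    ∑ x, walkW y Sh ρ ℓ x x ≤ n * (1 + β) ^ (ℓ + 1) := by
  classical
  obtain ⟨iO, iI, _, _⟩ := walkW_bound H ρ hρ b β hb hβ ℓ le_rfl
  have hn' : (0:ℝ) < n := by exact_mod_cast H.npos
  have hRl := H.Rl0
  have hRh : Rl ≤ Rh := (H.lo 0 (by omega)).trans (H.hi 0 (by omega))
  have hR1 : 1 ≤ Rh / Rl := by rw [le_div_iff₀ hRl]; linarith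
  have hb1 : 1 ≤ b := by
    rw [hb]; have : 0 ≤ 2 * ρ * (ℓ + 1) * (Rh / Rl) := by positivity
    linarith
  have hβ0 : 0 ≤ β := by rw [hβ]; positivity
  set a := (1 + β) ^ ℓ with ha
  have ha0 : 0 < a := by positivity
  have hirr : ∀ x, ¬ Sh x x := by
    intro x hx
    obtain ⟨i, hi, ⟨h1, h2⟩ | ⟨h1, h2⟩⟩ := H.sh _ _ hx
    · have := H.inj i (i+1) hi.le hi (h1.symm.trans h2); omega
    · have := H.inj i (i+1) hi.le hi (h2.symm.trans h1); omega
  have hterm : ∀ x, walkW y Sh ρ ℓ x x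
      ≤ a + ∑ i ∈ Finset.range (ℓ + 1), if x = v i then a * b else 0 := by
    intro x
    have hnn : 0 ≤ ∑ i ∈ Finset.range (ℓ + 1), (if x = v i then a * b else 0) :=
      Finset.sum_nonneg fun i _ => by split_ifs <;> positivity
    by_cases hx : ∀ i ≤ ℓ, x ≠ v i
    · exact (iO x x hx).trans (by linarith)
    · push Not at hx
      obtain ⟨i, hi, rfl⟩ := hx
      refine (iI _ i hi (hirr _)).trans ?_
      have : a * b ≤ ∑ j ∈ Finset.range (ℓ + 1), (if v i = v j then a * b else 0) := by
        refine le_trans ?_ (Finset.single_le_sum (f := fun j => if v i = v j then a * b else 0)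
          (fun j _ => by split_ifs <;> positivity) (Finset.mem_range.2 (Nat.lt_succ_of_le hi)))
        simp
      linarith
  refine (Finset.sum_le_sum fun x _ => hterm x).trans ?_
  rw [Finset.sum_add_distrib, Finset.sum_comm]
  simp only [Finset.sum_ite_eq', Finset.mem_univ, if_true, Finset.sum_const, Finset.card_univ,
    Fintype.card_fin, Finset.card_range, nsmul_eq_mul]
  rw [pow_succ, ← ha, hβ]
  apply le_of_eq
  push_cast
  field_simp

open Classical in
lemma share_sum {n ℓ : ℕ} {v : ℕ → Fin n} {φ : ℕ → ℝ} {Rl Rh : ℝ} {y : Fin n → Fin n → ℝ}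
    {Sh : Fin n → Fin n → Prop} (H : StepHyp n ℓ v φ Rl Rh y Sh)
    (hn : 3 * ((ℓ:ℝ) + 1) ^ 3 * (Rh / Rl) ≤ n) :
    ∑ γ : Path n ℓ, (if ∃ i : Fin ℓ, Sh (γ.1 i.castSucc) (γ.1 i.succ) then
      ∏ i : Fin ℓ, y (γ.1 i.castSucc) (γ.1 i.succ) else 0) ≤ 9 * ((ℓ:ℝ) + 1) ^ 3 * (Rh / Rl) := by
  have hn' : (0:ℝ) < n := by exact_mod_cast H.npos
  have hRl := H.Rl0
  have hRh : Rl ≤ Rh := (H.lo 0 (by omega)).trans (H.hi 0 (by omega))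
  have hR1 : 1 ≤ Rh / Rl := by rw [le_div_iff₀ hRl]; linarith
  set R := Rh / Rl with hR
  set ρ : ℝ := n / (3 * ((ℓ:ℝ) + 1) ^ 3 * R) with hρd
  have hρ : 1 ≤ ρ := by rw [hρd, le_div_iff₀ (by positivity)]; linarith
  set b : ℝ := 1 + 2 * ρ * (ℓ + 1) * R with hb
  set β : ℝ := (ℓ + 1) * b / n with hβ
  have htot := walk_total H ρ hρ b β hb hβ
  have hl1 : (1:ℝ) ≤ ℓ + 1 := by linarith [Nat.cast_nonneg (α := ℝ) ℓ]
  have hb3 : b ≤ 3 * ρ * (ℓ + 1) * R := by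
    have : 1 ≤ ρ * (ℓ + 1) * R := one_le_mul_of_one_le_of_one_le (one_le_mul_of_one_le_of_one_le hρ hl1) hR1
    rw [hb]; linarith
  have hβ1 : β ≤ 1 / (ℓ + 1) := by
    calc β ≤ (ℓ + 1) * (3 * ρ * (ℓ + 1) * R) / n := by rw [hβ]; gcongr
      _ = 1 / (ℓ + 1) := by rw [hρd]; field_simp
  have hβ0 : 0 ≤ β := by rw [hβ]; positivity
  have hexp : (1 + β) ^ (ℓ + 1) ≤ 3 := by
    have h1 : 1 + β ≤ Real.exp (1 / (ℓ + 1)) := by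
      have := Real.add_one_le_exp (1 / ((ℓ:ℝ) + 1)); linarith
    calc (1 + β) ^ (ℓ + 1) ≤ Real.exp (1 / (ℓ + 1)) ^ (ℓ + 1) := by gcongr
      _ = Real.exp 1 := by
        rw [← Real.exp_nat_mul]; congr 1; push_cast; field_simp
      _ ≤ 3 := by linarith [Real.exp_one_lt_d9]
  have hnn : ∀ g : Fin (ℓ + 1) → Fin n, 0 ≤ seqW y Sh ρ ℓ (g 0) (g 0) (Fin.tail g) :=
    fun g => seqW_nonneg H.ynn hρ _ _ _ _
  have hsum : ∑ x, walkW y Sh ρ ℓ x x = ∑ g : Fin (ℓ + 1) → Fin n, seqW y Sh ρ ℓ (g 0) (g 0) (Fin.tail g) := by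
    rw [← (Fin.consEquiv fun _ : Fin (ℓ+1) => Fin n).sum_comp, Fintype.sum_prod_type]
    refine Finset.sum_congr rfl fun a _ => ?_
    rw [walkW_eq]
    refine Finset.sum_congr rfl fun x _ => ?_
    simp [Fin.consEquiv]
  have hirr : ∀ x, ¬ Sh x x := by
    intro x hx
    obtain ⟨i, hi, ⟨h1, h2⟩ | ⟨h1, h2⟩⟩ := H.sh _ _ hx
    · have := H.inj i (i+1) hi.le hi (h1.symm.trans h2); omega
    · have := H.inj i (i+1) hi.le hi (h2.symm.trans h1); omega
  have hmain : ∑ γ : Path n ℓ, ρ * (if ∃ i : Fin ℓ, Sh (γ.1 i.castSucc) (γ.1 i.succ) then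
      ∏ i : Fin ℓ, y (γ.1 i.castSucc) (γ.1 i.succ) else 0) ≤ n * (1 + β) ^ (ℓ + 1) := by
    refine le_trans ?_ (hsum ▸ htot)
    have : ∑ γ : Path n ℓ, seqW y Sh ρ ℓ (γ.1 0) (γ.1 0) (Fin.tail γ.1)
        ≤ ∑ g : Fin (ℓ + 1) → Fin n, seqW y Sh ρ ℓ (g 0) (g 0) (Fin.tail g) := by
      have hm := Finset.sum_map (Finset.univ : Finset (Path n ℓ)) (Function.Embedding.subtype _)
        (fun g : Fin (ℓ + 1) → Fin n => seqW y Sh ρ ℓ (g 0) (g 0) (Fin.tail g))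
      refine (hm.symm.le).trans ?_
      exact Finset.sum_le_sum_of_subset_of_nonneg (Finset.subset_univ _) fun g _ _ => hnn g
    refine le_trans (Finset.sum_le_sum fun γ _ => ?_) this
    split_ifs with h
    · exact (seqW_ge H.ynn hρ ℓ (γ.1 0) γ.1 γ.2 (fun j h => absurd (γ.2 h) (Fin.succ_ne_zero _))).2 (hirr _) h
    · rw [mul_zero]; exact hnn _
  rw [← Finset.mul_sum] at hmain
  have h9 : ρ * ∑ γ : Path n ℓ, (if ∃ i : Fin ℓ, Sh (γ.1 i.castSucc) (γ.1 i.succ) then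
      ∏ i : Fin ℓ, y (γ.1 i.castSucc) (γ.1 i.succ) else 0) ≤ ρ * (9 * ((ℓ:ℝ) + 1) ^ 3 * R) := by
    refine hmain.trans ?_
    have : ρ * (9 * ((ℓ:ℝ) + 1) ^ 3 * R) = n * 3 := by rw [hρd]; field_simp; norm_num
    rw [this]; gcongr
  exact le_of_mul_le_mul_left h9 (by linarith)

end

section
/-- the good event: the rescaled partial sums stay in a tube of half-width `H`. -/
def good {n ℓ : ℕ} (τ H : ℝ) (γ : Path n ℓ) : Set (Sym2 (Fin n) → ℝ) :=
  {ω | ∀ p ≤ ℓ, |Real.exp 1 * partialSum ω γ p - p * τ| ≤ H}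

open Classical in
/-- averaged edge factor. -/
noncomputable def wgt {n ℓ : ℕ} (γ : Path n ℓ) (ω : Sym2 (Fin n) → ℝ) (e : Sym2 (Fin n)) : ℝ :=
  if ∃ i, γ.edge i = e then Real.exp (-(Real.exp 1 * ω e)) else 1 / (1 + Real.exp 1 * n)

lemma partialSum_succ {n ℓ : ℕ} (ω : Sym2 (Fin n) → ℝ) (γ : Path n ℓ) (i : Fin ℓ) :
    partialSum ω γ (i + 1) = partialSum ω γ i + ω (γ.edge i) := by
  unfold partialSum
  have : ω (γ.edge i) = ∑ j : Fin ℓ, if j = i then ω (γ.edge j) else 0 := by simp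
  rw [this, ← Finset.sum_add_distrib]
  refine Finset.sum_congr rfl fun j _ => ?_
  by_cases h : j = i
  · subst h; simp
  · have : (j:ℕ) ≠ i := fun h' => h (Fin.ext h')
    by_cases h2 : (j:ℕ) < i
    · rw [if_pos (by omega), if_pos h2, if_neg h, add_zero]
    · rw [if_neg (by omega), if_neg h2, if_neg h, add_zero]

lemma partialSum_top {n ℓ : ℕ} (ω : Sym2 (Fin n) → ℝ) (γ : Path n ℓ) :
    partialSum ω γ ℓ = weight ω γ := by
  unfold partialSum weight
  exact Finset.sum_congr rfl fun j _ => if_pos j.2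

lemma good_stepHyp {n ℓ : ℕ} (hn : 0 < n) (τ H : ℝ) (hτ : τ ≤ 1) (γ : Path n ℓ)
    (ω : Sym2 (Fin n) → ℝ) (hω : ω ∈ good τ H γ) :
    StepHyp n ℓ (fun i => γ.1 ⟨min i ℓ, by omega⟩) (fun p => Real.exp (p - Real.exp 1 * partialSum ω γ p))
      (Real.exp (-H)) (Real.exp (H + ℓ * (1 - τ))) (fun a b => Real.exp 1 * wgt γ ω s(a, b))
      (fun a b => ∃ i, γ.edge i = s(a, b)) := by
  have hn' : (0:ℝ) < n := by exact_mod_cast hn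
  have hedge : ∀ i (hi : i < ℓ), γ.edge ⟨i, hi⟩ = s(γ.1 ⟨min i ℓ, by omega⟩, γ.1 ⟨min (i+1) ℓ, by omega⟩) := by
    intro i hi
    unfold Path.edge
    have e1 : (⟨i, hi⟩ : Fin ℓ).castSucc = ⟨min i ℓ, by omega⟩ := by ext; simp; omega
    have e2 : (⟨i, hi⟩ : Fin ℓ).succ = ⟨min (i+1) ℓ, by omega⟩ := by ext; simp; omega
    rw [e1, e2]
  have hy : ∀ i (hi : i < ℓ), Real.exp 1 * wgt γ ω (γ.edge ⟨i, hi⟩)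
      = Real.exp ((i + 1 : ℕ) - Real.exp 1 * partialSum ω γ (i + 1)) / Real.exp (i - Real.exp 1 * partialSum ω γ i) := by
    intro i hi
    unfold wgt
    rw [if_pos ⟨_, rfl⟩, ← Real.exp_add, ← Real.exp_sub]
    have := partialSum_succ ω γ ⟨i, hi⟩
    simp only at this
    rw [this]
    congr 1; push_cast; ring
  refine ⟨hn, ?_, ?_, ?_, ?_, ?_, ?_, ?_, ?_, Real.exp_pos _, ?_, ?_⟩
  · intro i j hi hj h
    have := congrArg Fin.val (γ.2 h)
    simp only at this; omega
  · intro a b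
    unfold wgt; split_ifs <;> positivity
  · intro a b h
    unfold wgt
    rw [if_neg h, mul_one_div, div_le_div_iff₀ (by positivity) hn']
    linarith
  · rintro a b ⟨i, hi⟩
    refine ⟨i, i.2, ?_⟩
    have := hedge i i.2
    rw [Fin.eta, hi, Sym2.eq_iff] at this
    exact this
  · intro i hi
    rw [← hedge i hi]; exact hy i hi
  · intro i hi
    rw [Sym2.eq_swap, ← hedge i hi]; exact hy i hi
  · intro i hi
    exact ⟨_, hedge i hi⟩
  · intro i hi
    exact ⟨⟨i, hi⟩, (hedge i hi).trans Sym2.eq_swap⟩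
  · intro p hp
    have := abs_le.1 (hω p hp)
    apply Real.exp_le_exp.2
    have : (0:ℝ) ≤ p * (1 - τ) := mul_nonneg (Nat.cast_nonneg _) (by linarith)
    linarith
  · intro p hp
    have := abs_le.1 (hω p hp)
    apply Real.exp_le_exp.2
    have : (p:ℝ) * (1 - τ) ≤ ℓ * (1 - τ) := mul_le_mul_of_nonneg_right (by exact_mod_cast hp) (by linarith)
    linarith

/-- two paths share an edge -/
def Share {n ℓ : ℕ} (γ γ' : Path n ℓ) : Prop := ∃ j i, γ.edge i = γ'.edge j

open Classical in
lemma good_sum {n ℓ : ℕ} (hn : 0 < n) (τ H : ℝ) (hτ : τ ≤ 1) (γ : Path n ℓ)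
    (ω : Sym2 (Fin n) → ℝ) (hω : ω ∈ good τ H γ)
    (hR : 3 * ((ℓ:ℝ) + 1) ^ 3 * Real.exp (2 * H + ℓ * (1 - τ)) ≤ n) :
    ∑ γ' : Path n ℓ, (if Share γ γ' then
      ∏ i : Fin ℓ, (Real.exp 1 * wgt γ ω (γ'.edge i)) else 0)
      ≤ 9 * ((ℓ:ℝ) + 1) ^ 3 * Real.exp (2 * H + ℓ * (1 - τ)) := by
  have hq : Real.exp (H + ℓ * (1 - τ)) / Real.exp (-H) = Real.exp (2 * H + ℓ * (1 - τ)) := by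
    rw [← Real.exp_sub]; congr 1; ring
  have := share_sum (good_stepHyp hn τ H hτ γ ω hω) (by rw [hq]; exact hR)
  rw [hq] at this
  convert this using 3
  · exact Iff.rfl
  · rfl

end

section
lemma second_moment {Ω ι : Type*} [MeasurableSpace Ω] [Fintype ι] (μ : Measure Ω)
    [IsProbabilityMeasure μ] (A : ι → Set Ω) (hA : ∀ i, MeasurableSet (A i)) (K : ℝ)
    (hm : 0 < ∑ i, μ.real (A i))
    (h2 : ∑ i, ∑ j, μ.real (A i ∩ A j) ≤ (∑ i, μ.real (A i)) ^ 2 + K * ∑ i, μ.real (A i)) :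
    μ.real (⋃ i, A i)ᶜ ≤ K / ∑ i, μ.real (A i) := by
  set m := ∑ i, μ.real (A i) with hmd
  set f : ι → Ω → ℝ := fun i => (A i).indicator 1 with hf
  have hfi : ∀ i, Integrable (f i) μ := fun i => (integrable_const (1:ℝ)).indicator (hA i)
  have hffi : ∀ i j, Integrable (fun ω => f i ω * f j ω) μ := by
    intro i j
    have : (fun ω => f i ω * f j ω) = (A i ∩ A j).indicator 1 := by
      ext ω; simp only [hf]; rw [Set.inter_indicator_one]; rfl
    rw [this]
    exact (integrable_const (1:ℝ)).indicator ((hA i).inter (hA j))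
  have hff : ∀ i j, ∫ ω, f i ω * f j ω ∂μ = μ.real (A i ∩ A j) := by
    intro i j
    have : (fun ω => f i ω * f j ω) = (A i ∩ A j).indicator 1 := by
      ext ω; simp only [hf]; rw [Set.inter_indicator_one]; rfl
    rw [this, integral_indicator_one ((hA i).inter (hA j))]
  have hfo : ∀ i, ∫ ω, f i ω ∂μ = μ.real (A i) := fun i => integral_indicator_one (hA i)
  have hvar : ∫ ω, (∑ i, f i ω - m) ^ 2 ∂μ = ∑ i, ∑ j, μ.real (A i ∩ A j) - m ^ 2 := by
    have e : ∀ ω, (∑ i, f i ω - m) ^ 2 = (∑ i, ∑ j, f i ω * f j ω) - ((2 * m) * ∑ i, f i ω - m ^ 2) := by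
      intro ω
      rw [← Finset.sum_mul_sum]; ring
    simp only [e]
    rw [integral_sub, integral_sub, integral_finsetSum, integral_const_mul, integral_finsetSum]
    · simp only [hfo]
      rw [← hmd]
      have : ∀ i, ∫ ω, ∑ j, f i ω * f j ω ∂μ = ∑ j, μ.real (A i ∩ A j) := by
        intro i; rw [integral_finsetSum _ fun j _ => hffi i j]; simp only [hff]
      simp only [this]
      simp; ring
    · exact fun i _ => hfi i
    · exact fun i _ => integrable_finsetSum _ fun j _ => hffi i j
    · exact (integrable_finsetSum _ fun j _ => hfi j).const_mul _
    · exact integrable_const _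
    · exact integrable_finsetSum _ fun i _ => integrable_finsetSum _ fun j _ => hffi i j
    · exact ((integrable_finsetSum _ fun j _ => hfi j).const_mul _).sub (integrable_const _)
  have hIntg : Integrable (fun ω => (∑ i, f i ω - m) ^ 2) μ := by
    have e : ∀ ω, (∑ i, f i ω - m) ^ 2 = (∑ i, ∑ j, f i ω * f j ω) - ((2 * m) * ∑ i, f i ω - m ^ 2) := by
      intro ω
      rw [← Finset.sum_mul_sum]; ring
    simp only [e]
    exact (integrable_finsetSum _ fun i _ => integrable_finsetSum _ fun j _ => hffi i j).sub
     (((integrable_finsetSum _ fun j _ => hfi j).const_mul _).sub (integrable_const _))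
  have hB : MeasurableSet (⋃ i, A i)ᶜ := (MeasurableSet.iUnion hA).compl
  have hlow : m ^ 2 * μ.real (⋃ i, A i)ᶜ ≤ ∫ ω, (∑ i, f i ω - m) ^ 2 ∂μ := by
    rw [← integral_indicator_one hB, ← integral_const_mul]
    refine integral_mono (((integrable_const (1:ℝ)).indicator hB).const_mul _) hIntg fun ω => ?_
    simp only
    by_cases h : ω ∈ (⋃ i, A i)ᶜ
    · rw [Set.indicator_of_mem h]
      have : ∀ i, f i ω = 0 := fun i => Set.indicator_of_notMem
        (fun h' => h (Set.mem_iUnion.2 ⟨i, h'⟩)) _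
      simp [this]
    · rw [Set.indicator_of_notMem h]; simp; positivity
  rw [hvar] at hlow
  rw [le_div_iff₀ hm]
  have : m * (μ.real (⋃ i, A i)ᶜ * m) ≤ m * K := by nlinarith
  exact le_of_mul_le_mul_left this hm

lemma dependsOn_partialSum {n ℓ : ℕ} (γ : Path n ℓ) {x y : Sym2 (Fin n) → ℝ}
    (h : ∀ e ∈ Set.range γ.edge, x e = y e) (p : ℕ) : partialSum x γ p = partialSum y γ p := by
  unfold partialSum
  refine Finset.sum_congr rfl fun i _ => ?_
  rw [h _ ⟨i, rfl⟩]

lemma good_dep {n ℓ : ℕ} (τ H : ℝ) (γ : Path n ℓ) :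
    DependsOn ((good τ H γ).indicator (1 : (Sym2 (Fin n) → ℝ) → ENNReal)) (Set.range γ.edge) := by
  intro x y h
  have : x ∈ good τ H γ ↔ y ∈ good τ H γ := by
    unfold good
    simp only [Set.mem_ofPred_eq]
    simp only [dependsOn_partialSum γ h]
  by_cases hx : x ∈ good τ H γ
  · rw [Set.indicator_of_mem hx, Set.indicator_of_mem (this.1 hx)]; rfl
  · rw [Set.indicator_of_notMem hx, Set.indicator_of_notMem (fun h => hx (this.2 h))]

lemma measurable_partialSum {n ℓ : ℕ} (γ : Path n ℓ) (p : ℕ) :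
    Measurable fun ω => partialSum ω γ p := by
  unfold partialSum
  refine Finset.measurable_sum _ fun i _ => ?_
  split_ifs
  · exact measurable_pi_apply _
  · exact measurable_const

lemma good_meas {n ℓ : ℕ} (τ H : ℝ) (γ : Path n ℓ) : MeasurableSet (good τ H γ) := by
  have : good τ H γ = ⋂ p, ⋂ (_ : p ≤ ℓ), {ω | |Real.exp 1 * partialSum ω γ p - p * τ| ≤ H} := by
    ext ω; simp [good]
  rw [this]
  refine MeasurableSet.iInter fun p => MeasurableSet.iInter fun _ => ?_
  have := measurable_partialSum γ p
  exact measurableSet_le (by fun_prop) measurable_const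

lemma good_indep {n ℓ : ℕ} (hn : 0 < n) (τ H : ℝ) (γ γ' : Path n ℓ) (h : ¬ Share γ γ') :
    P n (good τ H γ ∩ good τ H γ') = P n (good τ H γ) * P n (good τ H γ') := by
  have := probExp n hn
  have h1 := lintegral_mul_dep (expMeasure ((n:ℝ)⁻¹)) ((good τ H γ).indicator 1)
    ((good τ H γ').indicator 1) (measurable_one.indicator (good_meas _ _ _))
    (measurable_one.indicator (good_meas _ _ _)) _ _ (good_dep τ H γ) (good_dep τ H γ') (by
      rw [Set.disjoint_left]
      rintro _ ⟨i, rfl⟩ ⟨j, hj⟩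
      exact h ⟨j, i, hj.symm⟩)
  have e : ∀ ω, (good τ H γ).indicator (1 : (Sym2 (Fin n) → ℝ) → ENNReal) ω * (good τ H γ').indicator 1 ω
      = (good τ H γ ∩ good τ H γ').indicator 1 ω := by
    intro ω; rw [Set.inter_indicator_one]; rfl
  simp only [e] at h1
  rw [lintegral_indicator_one ((good_meas _ _ _).inter (good_meas _ _ _)),
    lintegral_indicator_one (good_meas _ _ _), lintegral_indicator_one (good_meas _ _ _)] at h1
  exact h1

lemma good_pair {n ℓ : ℕ} (hn : 0 < n) (τ H : ℝ) (hθ : ℓ * τ + H ≤ ℓ) (γ γ' : Path n ℓ) :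
    P n (good τ H γ ∩ good τ H γ') ≤ ∫⁻ ω, (good τ H γ).indicator 1 ω *
      ENNReal.ofReal (∏ i : Fin ℓ, (Real.exp 1 * wgt γ ω (γ'.edge i))) ∂(P n) := by
  classical
  have := probExp n hn
  set E := Real.exp 1 with hE
  have hE0 : 0 < E := Real.exp_pos 1
  set s : Finset (Fin ℓ) := univ.filter fun i => ∃ j, γ.edge j = γ'.edge i with hs
  set F : (Sym2 (Fin n) → ℝ) → ENNReal := fun ω => (good τ H γ).indicator 1 ω *
    ENNReal.ofReal (∏ i ∈ s, (E * Real.exp (-(E * ω (γ'.edge i))))) with hF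
  set G : (Sym2 (Fin n) → ℝ) → ENNReal := fun ω =>
    ENNReal.ofReal (E ^ sᶜ.card) * ENNReal.ofReal (Real.exp (-(E * ∑ i ∈ sᶜ, ω (γ'.edge i)))) with hG
  have hFm : Measurable F := by
    refine (measurable_one.indicator (good_meas _ _ _)).mul ?_
    fun_prop
  have hGm : Measurable G := by
    simp only [hG]
    fun_prop
  have hGint : ∫⁻ ω, G ω ∂(P n) = ENNReal.ofReal (∏ i ∈ sᶜ, (E * (1 / (1 + E * n)))) := by
    simp only [hG]
    rw [lintegral_const_mul _ (by fun_prop), lintegral_exp_sum hn γ' sᶜ E hE0.le,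
      ← ENNReal.ofReal_mul (by positivity), Finset.prod_const, mul_pow]
  have hprod : ∫⁻ ω, F ω * G ω ∂(P n) = (∫⁻ ω, F ω ∂(P n)) * ∫⁻ ω, G ω ∂(P n) := by
    refine lintegral_mul_dep _ F G hFm hGm (Set.range γ.edge) (Set.range γ.edge)ᶜ ?_ ?_ disjoint_compl_right
    · intro x y h
      simp only [hF]
      rw [good_dep τ H γ h]
      congr 2
      refine Finset.prod_congr rfl fun i hi => ?_
      rw [h _ (by simpa [hs] using hi)]
    · intro x y h
      simp only [hG]
      congr 5
      refine Finset.sum_congr rfl fun i hi => ?_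
      rw [h _ (by simpa [hs] using hi)]
  calc P n (good τ H γ ∩ good τ H γ')
      = ∫⁻ ω, (good τ H γ ∩ good τ H γ').indicator 1 ω ∂(P n) := by
        rw [lintegral_indicator_one ((good_meas _ _ _).inter (good_meas _ _ _))]
    _ ≤ ∫⁻ ω, F ω * G ω ∂(P n) := by
        refine lintegral_mono fun ω => ?_
        rw [Set.inter_indicator_one, Pi.mul_apply]
        simp only [hF, hG]
        rw [mul_assoc]
        refine mul_le_mul_right ?_ _
        by_cases hω : ω ∈ good τ H γ'
        · rw [Set.indicator_of_mem hω, Pi.one_apply, ← ENNReal.ofReal_mul (by positivity),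
            ← ENNReal.ofReal_mul (Finset.prod_nonneg fun i _ => by positivity), ← ENNReal.ofReal_one]
          apply ENNReal.ofReal_le_ofReal
          have e1 : ∏ i ∈ s, (E * Real.exp (-(E * ω (γ'.edge i))))
              = E ^ s.card * Real.exp (-(E * ∑ i ∈ s, ω (γ'.edge i))) := by
            rw [Finset.prod_mul_distrib, Finset.prod_const, ← Real.exp_sum, Finset.mul_sum,
              Finset.sum_neg_distrib]
          have e2 : s.card + sᶜ.card = ℓ := by
            rw [Finset.card_add_card_compl, Fintype.card_fin]
          have e3 : ∑ i ∈ s, ω (γ'.edge i) + ∑ i ∈ sᶜ, ω (γ'.edge i) = weight ω γ' := by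
            rw [Finset.sum_add_sum_compl]; rfl
          have e4 : E ^ s.card * Real.exp (-(E * ∑ i ∈ s, ω (γ'.edge i))) *
              (E ^ sᶜ.card * Real.exp (-(E * ∑ i ∈ sᶜ, ω (γ'.edge i))))
              = E ^ ℓ * Real.exp (-(E * weight ω γ')) := by
            have : Real.exp (-(E * weight ω γ')) = Real.exp (-(E * ∑ i ∈ s, ω (γ'.edge i))) *
                Real.exp (-(E * ∑ i ∈ sᶜ, ω (γ'.edge i))) := by
              rw [← Real.exp_add, ← e3]; congr 1; ring
            have e5 : E ^ ℓ = E ^ s.card * E ^ sᶜ.card := by rw [← pow_add, e2]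
            rw [this, e5]; ring
          rw [e1, e4, hE, ← Real.exp_nat_mul, ← Real.exp_add]
          have h5 := abs_le.1 (hω ℓ le_rfl)
          rw [partialSum_top] at h5
          apply Real.one_le_exp
          linarith
        · rw [Set.indicator_of_notMem hω]; exact zero_le
    _ = (∫⁻ ω, F ω ∂(P n)) * ENNReal.ofReal (∏ i ∈ sᶜ, (E * (1 / (1 + E * n)))) := by
        rw [hprod, hGint]
    _ = ∫⁻ ω, F ω * ENNReal.ofReal (∏ i ∈ sᶜ, (E * (1 / (1 + E * n)))) ∂(P n) := by
        rw [lintegral_mul_const _ hFm]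
    _ = _ := by
        refine lintegral_congr fun ω => ?_
        simp only [hF]
        rw [mul_assoc, ← ENNReal.ofReal_mul (Finset.prod_nonneg fun i _ => by positivity)]
        congr 2
        rw [← Finset.prod_mul_prod_compl s]
        congr 1
        · refine Finset.prod_congr rfl fun i hi => ?_
          rw [wgt, if_pos (by simpa [hs] using hi)]
        · refine Finset.prod_congr rfl fun i hi => ?_
          rw [wgt, if_neg (by simpa [hs] using hi)]

end

section
lemma good_row {n ℓ : ℕ} (hn : 0 < n) (τ H : ℝ) (hτ : τ ≤ 1) (hθ : ℓ * τ + H ≤ ℓ)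
    (hR : 3 * ((ℓ:ℝ) + 1) ^ 3 * Real.exp (2 * H + ℓ * (1 - τ)) ≤ n) (γ : Path n ℓ) :
    ∑ γ' : Path n ℓ, P n (good τ H γ ∩ good τ H γ')
      ≤ P n (good τ H γ) * ∑ γ' : Path n ℓ, P n (good τ H γ')
        + ENNReal.ofReal (9 * ((ℓ:ℝ) + 1) ^ 3 * Real.exp (2 * H + ℓ * (1 - τ))) * P n (good τ H γ) := by
  classical
  have hn' : (0:ℝ) < n := by exact_mod_cast hn
  set Ψ : Path n ℓ → (Sym2 (Fin n) → ℝ) → ℝ := fun γ' ω => if Share γ γ' then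
      ∏ i : Fin ℓ, (Real.exp 1 * wgt γ ω (γ'.edge i)) else 0 with hΨ
  have hw : ∀ ω e, 0 ≤ wgt γ ω e := by
    intro ω e; unfold wgt; split_ifs <;> positivity
  have hwm : ∀ e, Measurable fun ω => wgt γ ω e := by
    intro e; unfold wgt; split_ifs <;> fun_prop
  have hΨ0 : ∀ γ' ω, 0 ≤ Ψ γ' ω := by
    intro γ' ω; simp only [hΨ]; split_ifs
    · exact Finset.prod_nonneg fun i _ => mul_nonneg (Real.exp_pos _).le (hw _ _)
    · exact le_rfl
  have hΨm : ∀ γ', Measurable (Ψ γ') := by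
    intro γ'; simp only [hΨ]; split_ifs
    · exact Finset.measurable_prod _ fun i _ => (hwm _).const_mul _
    · exact measurable_const
  have hterm : ∀ γ', P n (good τ H γ ∩ good τ H γ') ≤ P n (good τ H γ) * P n (good τ H γ')
      + ∫⁻ ω, (good τ H γ).indicator 1 ω * ENNReal.ofReal (Ψ γ' ω) ∂(P n) := by
    intro γ'
    by_cases h : Share γ γ'
    · simp only [hΨ, if_pos h]
      exact (good_pair hn τ H hθ γ γ').trans le_add_self
    · rw [good_indep hn τ H γ γ' h]
      exact le_self_add
  refine (Finset.sum_le_sum fun γ' _ => hterm γ').trans ?_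
  rw [Finset.sum_add_distrib, Finset.mul_sum]
  refine add_le_add le_rfl ?_
  rw [← lintegral_finsetSum]
  · calc ∫⁻ ω, ∑ γ', (good τ H γ).indicator 1 ω * ENNReal.ofReal (Ψ γ' ω) ∂(P n)
        ≤ ∫⁻ ω, ENNReal.ofReal (9 * ((ℓ:ℝ) + 1) ^ 3 * Real.exp (2 * H + ℓ * (1 - τ))) *
            (good τ H γ).indicator 1 ω ∂(P n) := by
          refine lintegral_mono fun ω => ?_
          simp only
          rw [← Finset.mul_sum, mul_comm]
          by_cases hω : ω ∈ good τ H γ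
          · refine mul_le_mul_left ?_ _
            rw [← ENNReal.ofReal_sum_of_nonneg fun γ' _ => hΨ0 γ' ω]
            apply ENNReal.ofReal_le_ofReal
            have := good_sum hn τ H hτ γ ω hω hR
            convert this using 3
          · rw [Set.indicator_of_notMem hω]; simp
      _ = _ := by
        rw [lintegral_const_mul _ (measurable_one.indicator (good_meas _ _ _)),
          lintegral_indicator_one (good_meas _ _ _)]
  · intro γ' _
    exact (measurable_one.indicator (good_meas _ _ _)).mul (hΨm γ').ennreal_ofReal

lemma no_good {n ℓ : ℕ} (hn : 0 < n) (τ H : ℝ) (hτ : τ ≤ 1) (hθ : ℓ * τ + H ≤ ℓ)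
    (hR : 3 * ((ℓ:ℝ) + 1) ^ 3 * Real.exp (2 * H + ℓ * (1 - τ)) ≤ n)
    (q : ℝ) (hq : 0 < q) (hq2 : q ≤ ∑ γ : Path n ℓ, (P n).real (good τ H γ)) :
    (P n).real (⋃ γ : Path n ℓ, good τ H γ)ᶜ
      ≤ 9 * ((ℓ:ℝ) + 1) ^ 3 * Real.exp (2 * H + ℓ * (1 - τ)) / q := by
  have := probP n hn
  set K := 9 * ((ℓ:ℝ) + 1) ^ 3 * Real.exp (2 * H + ℓ * (1 - τ)) with hK
  have hK0 : 0 ≤ K := by positivity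
  refine (second_moment (P n) (fun γ : Path n ℓ => good τ H γ) (fun γ => good_meas _ _ _) K
    (hq.trans_le hq2) ?_).trans ?_
  · rw [sq, Finset.sum_mul, Finset.mul_sum, ← Finset.sum_add_distrib]
    refine Finset.sum_le_sum fun γ _ => ?_
    have h := good_row hn τ H hτ hθ hR γ
    rw [← hK] at h
    have hsum : ∀ f : Path n ℓ → Set (Sym2 (Fin n) → ℝ), (∑ γ', P n (f γ')) = ENNReal.ofReal (∑ γ', (P n).real (f γ')) := by
      intro f
      rw [ENNReal.ofReal_sum_of_nonneg fun _ _ => measureReal_nonneg]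
      exact Finset.sum_congr rfl fun _ _ => (ofReal_measureReal).symm
    rw [hsum, hsum, ← ofReal_measureReal (μ := P n) (s := good τ H γ), ← ENNReal.ofReal_mul measureReal_nonneg,
      ← ENNReal.ofReal_mul hK0, ← ENNReal.ofReal_add, ENNReal.ofReal_le_ofReal_iff] at h
    · exact h
    · have : 0 ≤ ∑ γ' : Path n ℓ, (P n).real (good τ H γ') := Finset.sum_nonneg fun _ _ => measureReal_nonneg
      positivity
    · have : 0 ≤ ∑ γ' : Path n ℓ, (P n).real (good τ H γ') := Finset.sum_nonneg fun _ _ => measureReal_nonneg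
      positivity
    · positivity
  · exact div_le_div_of_nonneg_left hK0 hq hq2

end

section
lemma int_exp_cos_integrable (k b : ℝ) :
    IntegrableOn (fun z => Real.exp (-z) * Real.cos (k * z + b)) (Set.Ioi 0) := by
  have h := integrableOn_exp_mul_Ioi (a := -1) (by norm_num) 0
  refine Integrable.mono h ?_ ?_
  · exact (Continuous.aestronglyMeasurable (by fun_prop))
  · refine Eventually.of_forall fun z => ?_
    rw [norm_mul, Real.norm_eq_abs, Real.norm_eq_abs, Real.norm_eq_abs, neg_one_mul]
    have := Real.abs_cos_le_one (k * z + b)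
    exact mul_le_of_le_one_right (abs_nonneg _) this

lemma int_exp_cos (k b : ℝ) :
    ∫ z in Set.Ioi (0:ℝ), Real.exp (-z) * Real.cos (k * z + b)
      = (Real.cos b - k * Real.sin b) / (1 + k ^ 2) := by
  have hk : 1 + k ^ 2 ≠ 0 := by positivity
  have := integral_Ioi_of_hasDerivAt_of_tendsto (a := (0:ℝ)) (m := 0)
    (f := fun z => Real.exp (-z) * ((k * Real.sin (k * z + b) - Real.cos (k * z + b)) / (1 + k ^ 2)))
    (f' := fun z => Real.exp (-z) * Real.cos (k * z + b)) (by
      apply Continuous.continuousWithinAt; fun_prop) (by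
      intro z _
      have h1 : HasDerivAt (fun z : ℝ => k * z + b) k z := by
        simpa using ((hasDerivAt_id z).const_mul k).add_const b
      have h2 : HasDerivAt (fun z : ℝ => Real.exp (-z)) (Real.exp (-z) * -1) z :=
        (hasDerivAt_neg z).exp
      have h3 := h2.mul (((h1.sin.const_mul k).sub h1.cos).div_const (1 + k ^ 2))
      refine HasDerivAt.congr_deriv (f' := _) h3 ?_
      simp only [Pi.sub_apply]
      field_simp
      ring) (int_exp_cos_integrable k b) (by
      have h1 : Tendsto (fun z : ℝ => Real.exp (-z)) atTop (nhds 0) :=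
        Real.tendsto_exp_neg_atTop_nhds_zero
      refine squeeze_zero_norm (a := fun z => Real.exp (-z) * ((|k| + 1) / (1 + k ^ 2))) ?_ ?_
      · intro z
        rw [norm_mul, norm_div, Real.norm_eq_abs, Real.norm_eq_abs, Real.norm_eq_abs, abs_of_pos (Real.exp_pos _),
          abs_of_pos (show (0:ℝ) < 1 + k ^ 2 by positivity)]
        gcongr
        calc |k * Real.sin (k * z + b) - Real.cos (k * z + b)|
            ≤ |k * Real.sin (k * z + b)| + |Real.cos (k * z + b)| := abs_sub _ _
          _ ≤ |k| + 1 := by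
            rw [abs_mul]
            have := Real.abs_cos_le_one (k * z + b)
            have := mul_le_of_le_one_right (abs_nonneg k) (Real.abs_sin_le_one (k * z + b))
            linarith
      · simpa using h1.mul_const ((|k| + 1) / (1 + k ^ 2)))
  rw [this]
  simp
  field_simp
  ring

lemma int_exp_cos' (k y : ℝ) :
    ∫ z in Set.Ioi (0:ℝ), Real.exp (-z) * Real.cos (k * z + (k * y - Real.arctan k))
      = (Real.sqrt (1 + k ^ 2))⁻¹ * Real.cos (k * y) := by
  have h0 : 0 < Real.sqrt (1 + k ^ 2) := Real.sqrt_pos.2 (by positivity)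
  have h1 : Real.sqrt (1 + k ^ 2) ^ 2 = 1 + k ^ 2 := Real.sq_sqrt (by positivity)
  rw [int_exp_cos, Real.cos_sub, Real.sin_sub, Real.cos_arctan, Real.sin_arctan, ← h1]
  field_simp
  rw [h1]; ring

lemma ofReal_integral_le {α : Type*} [MeasurableSpace α] {μ : Measure α} {f : α → ℝ}
    (hf : Integrable f μ) : ENNReal.ofReal (∫ x, f x ∂μ) ≤ ∫⁻ x, ENNReal.ofReal (f x) ∂μ := by
  calc ENNReal.ofReal (∫ x, f x ∂μ) ≤ ENNReal.ofReal (∫ x, max (f x) 0 ∂μ) := by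
        apply ENNReal.ofReal_le_ofReal
        exact integral_mono hf hf.pos_part fun x => le_max_left _ _
    _ = ∫⁻ x, ENNReal.ofReal (max (f x) 0) ∂μ :=
        ofReal_integral_eq_lintegral_ofReal hf.pos_part (Eventually.of_forall fun x => le_max_right _ _)
    _ = _ := by
        refine lintegral_congr fun x => ?_
        rcases le_total (f x) 0 with h | h
        · rw [max_eq_right h, ENNReal.ofReal_of_nonpos h, ENNReal.ofReal_zero]
        · rw [max_eq_left h]

/-- the sub-solution -/
noncomputable def qsub (A κ H k : ℝ) (m : ℕ) (y : ℝ) : ℝ :=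
  A ^ m * Real.exp (-(κ * y)) * Real.exp (-H) *
    ((Real.sqrt (1 + k ^ 2))⁻¹ ^ m * Real.cos (k * y) - m * Real.exp (-(2 * H)))

set_option maxHeartbeats 1000000 in
lemma qsub_step (n : ℕ) (hn : 0 < n) (k : ℝ) (hk : 0 < k) (τ H κ A : ℝ) (hτ : τ = Real.arctan k / k)
    (hH : H = Real.pi / (2 * k)) (hκ : κ = 1 - 1 / (Real.exp 1 * n))
    (hA : A = Real.exp (κ * τ) / (Real.exp 1 * n)) (m : ℕ) (y : ℝ) (hy : |y| ≤ H)
    (Q : ℝ → ENNReal) (hQm : Measurable Q)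
    (hQ : ∀ y, |y| ≤ H → ENNReal.ofReal (qsub A κ H k m y) ≤ Q y) :
    ENNReal.ofReal (qsub A κ H k (m + 1) y)
      ≤ ∫⁻ x, Q (y + Real.exp 1 * x - τ) ∂(expMeasure ((n:ℝ)⁻¹)) := by
  have hn' : (0:ℝ) < n := by exact_mod_cast hn
  set E := Real.exp 1 with hE
  have hE0 : 0 < E := Real.exp_pos 1
  have hpi := Real.pi_pos
  have hkH : k * H = Real.pi / 2 := by rw [hH]; field_simp
  have hkτ : k * τ = Real.arctan k := by rw [hτ]; field_simp
  have hkτ2 : k * τ ≤ Real.pi / 2 := by rw [hkτ]; exact (Real.arctan_lt_pi_div_two k).le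
  have hτ0 : 0 ≤ τ := by rw [hτ]; exact div_nonneg (Real.arctan_nonneg.2 hk.le) hk.le
  have hH0 : 0 < H := by rw [hH]; positivity
  set r := (Real.sqrt (1 + k ^ 2))⁻¹ with hr
  have hr0 : 0 ≤ r := by rw [hr]; positivity
  have hr1 : r ≤ 1 := by
    rw [hr]; apply inv_le_one_of_one_le₀
    rw [Real.one_le_sqrt]; nlinarith
  have hrm : r ^ m ≤ 1 := pow_le_one₀ hr0 hr1
  have hrm0 : 0 ≤ r ^ m := pow_nonneg hr0 m
  set δ := Real.exp (-(2 * H)) with hδ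
  have hδ0 : 0 < δ := Real.exp_pos _
  have hA0 : 0 < A := by rw [hA]; positivity
  set c := A ^ (m + 1) * Real.exp (-(κ * y)) * Real.exp (-H) with hc
  have hc0 : 0 < c := by positivity
  set F : ℝ → ℝ := fun z => c * (r ^ m * (Real.exp (-z) * Real.cos (k * z + (k * y - Real.arctan k)))
    - r ^ m * (Set.Ioi (2 * H)).indicator (fun z => Real.exp (-z)) z - m * δ * Real.exp (-z)) with hF
  have hi1 := int_exp_cos_integrable k (k * y - Real.arctan k)
  have hi3 : IntegrableOn (fun z => Real.exp (-z)) (Set.Ioi 0) := by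
    simpa [neg_one_mul] using integrableOn_exp_mul_Ioi (a := -1) (by norm_num) 0
  have hi2 : IntegrableOn ((Set.Ioi (2 * H)).indicator (fun z => Real.exp (-z))) (Set.Ioi 0) :=
    hi3.indicator measurableSet_Ioi
  have hFi : IntegrableOn F (Set.Ioi 0) :=
    (((hi1.const_mul _).sub (hi2.const_mul _)).sub (hi3.const_mul _)).const_mul c
  have hv3 : ∫ z in Set.Ioi (0:ℝ), Real.exp (-z) = 1 := integral_exp_neg_Ioi_zero
  have hv2 : ∫ z in Set.Ioi (0:ℝ), (Set.Ioi (2 * H)).indicator (fun z => Real.exp (-z)) z = δ := by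
    rw [integral_indicator measurableSet_Ioi, Measure.restrict_restrict measurableSet_Ioi,
      Set.inter_eq_left.2 (Set.Ioi_subset_Ioi (by linarith)), integral_exp_neg_Ioi]
  have hFv : ∫ z in Set.Ioi (0:ℝ), F z = c * (r ^ m * (r * Real.cos (k * y)) - r ^ m * δ - m * δ) := by
    simp only [hF]
    rw [integral_const_mul, integral_sub, integral_sub, integral_const_mul, integral_const_mul,
      integral_const_mul, hv3, hv2, int_exp_cos', mul_one]
    · exact hi1.const_mul _
    · exact hi2.const_mul _
    · exact (hi1.const_mul _).sub (hi2.const_mul _)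
    · exact hi3.const_mul _
  have hFlow : qsub A κ H k (m + 1) y ≤ ∫ z in Set.Ioi (0:ℝ), F z := by
    rw [hFv]
    unfold qsub
    rw [← hr, ← hδ, ← hc]
    apply mul_le_mul_of_nonneg_left _ hc0.le
    push_cast
    rw [pow_succ]
    nlinarith
  -- change of variables
  have hcv : ∫ z in Set.Ioi (0:ℝ), F z = ∫ x in Set.Ioi (0:ℝ), E * F (E * x) := by
    have e := integral_const_mul (μ := volume.restrict (Set.Ioi 0)) E (fun x => F (E * x))
    rw [e, integral_comp_mul_left_Ioi F 0 hE0, mul_zero, smul_eq_mul]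
    field_simp
  have hFi' : IntegrableOn (fun x => E * F (E * x)) (Set.Ioi 0) := by
    refine Integrable.const_mul ?_ E
    exact (integrableOn_Ioi_comp_mul_left_iff F 0 hE0).2 (by simpa using hFi)
  rw [lintegral_expMeasure _ _ (by fun_prop)]
  refine (ENNReal.ofReal_le_ofReal (hFlow.trans hcv.le)).trans ((ofReal_integral_le hFi').trans ?_)
  refine setLIntegral_mono' measurableSet_Ioi fun x hx => ?_
  have hx0 : 0 < x := hx
  set z := E * x with hz
  have hz0 : 0 < z := by positivity
  have hyl := abs_le.1 hy
  set w := y + z - τ with hw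
  have hkw : k * z + (k * y - Real.arctan k) = k * w := by rw [hw, ← hkτ]; ring
  by_cases hwI : |w| ≤ H
  · refine le_trans ?_ (mul_le_mul_right (hQ w hwI) _)
    rw [← ENNReal.ofReal_mul (by positivity)]
    apply ENNReal.ofReal_le_ofReal
    have hind : 0 ≤ (Set.Ioi (2 * H)).indicator (fun z => Real.exp (-z)) z :=
      Set.indicator_nonneg (fun _ _ => (Real.exp_pos _).le) _
    have h1 : F z ≤ c * (Real.exp (-z) * (r ^ m * Real.cos (k * w) - m * δ)) := by
      simp only [hF]
      rw [hkw]
      apply mul_le_mul_of_nonneg_left _ hc0.le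
      have := mul_nonneg hrm0 hind
      linarith
    refine (mul_le_mul_of_nonneg_left h1 hE0.le).trans (le_of_eq ?_)
    unfold qsub
    rw [← hr, ← hδ]
    have h2 : E * c * Real.exp (-z) = (n:ℝ)⁻¹ * Real.exp (-((n:ℝ)⁻¹ * x)) * (A ^ m * Real.exp (-(κ * w)) * Real.exp (-H)) := by
      rw [hc, pow_succ]
      have h3 : E * A * Real.exp (-(κ * y)) * Real.exp (-z) = (n:ℝ)⁻¹ * Real.exp (-((n:ℝ)⁻¹ * x)) * Real.exp (-(κ * w)) := by
        rw [hA, show E * (Real.exp (κ * τ) / (E * n)) = (n:ℝ)⁻¹ * Real.exp (κ * τ) by field_simp,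
          mul_assoc, mul_assoc, mul_assoc, ← Real.exp_add, ← Real.exp_add, ← Real.exp_add]
        congr 2
        rw [hw, hz, hκ]
        field_simp
        ring
      linear_combination (A ^ m * Real.exp (-H)) * h3
    linear_combination (r ^ m * Real.cos (k * w) - m * δ) * h2
  · have : F z ≤ 0 := by
      simp only [hF]
      rw [hkw]
      apply mul_nonpos_of_nonneg_of_nonpos hc0.le
      have hmd : 0 ≤ m * δ * Real.exp (-z) := by positivity
      by_cases hz2 : 2 * H < z
      · rw [Set.indicator_of_mem (show z ∈ Set.Ioi (2 * H) from hz2)]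
        have : Real.exp (-z) * Real.cos (k * w) ≤ Real.exp (-z) :=
          mul_le_of_le_one_right (Real.exp_pos _).le (Real.cos_le_one _)
        have := mul_le_mul_of_nonneg_left this hrm0
        linarith
      · rw [Set.indicator_of_notMem (show z ∉ Set.Ioi (2 * H) from hz2), mul_zero, sub_zero]
        have hcos : Real.cos (k * w) ≤ 0 := by
          rw [not_le, lt_abs] at hwI
          rcases hwI with h | h
          · apply Real.cos_nonpos_of_pi_div_two_le_of_le
            · rw [← hkH]; exact mul_le_mul_of_nonneg_left h.le hk.le
            · have : w ≤ 3 * H := by rw [hw]; linarith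
              have := mul_le_mul_of_nonneg_left this hk.le
              nlinarith
          · rw [← Real.cos_neg]
            apply Real.cos_nonpos_of_pi_div_two_le_of_le
            · have := mul_le_mul_of_nonneg_left h.le hk.le
              linarith
            · have : -w ≤ H + τ := by rw [hw]; linarith
              have := mul_le_mul_of_nonneg_left this hk.le
              nlinarith
        have : r ^ m * (Real.exp (-z) * Real.cos (k * w)) ≤ 0 :=
          mul_nonpos_of_nonneg_of_nonpos hrm0 (mul_nonpos_of_nonneg_of_nonpos (Real.exp_pos _).le hcos)
        linarith
    rw [ENNReal.ofReal_of_nonpos (mul_nonpos_of_nonneg_of_nonpos hE0.le this)]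
    exact zero_le

end

section
/-- sequences staying in the tube -/
def tube (τ H : ℝ) (m : ℕ) (y : ℝ) : Set (Fin m → ℝ) :=
  {x | ∀ p ≤ m, |y + ∑ i : Fin m, if (i:ℕ) < p then (Real.exp 1 * x i - τ) else 0| ≤ H}

lemma tube_succ (τ H : ℝ) (m : ℕ) (y : ℝ) (x : Fin (m + 1) → ℝ) :
    x ∈ tube τ H (m + 1) y ↔ |y| ≤ H ∧ Fin.tail x ∈ tube τ H m (y + Real.exp 1 * x 0 - τ) := by
  have key : ∀ p, y + ∑ i : Fin (m + 1), (if (i:ℕ) < p + 1 then (Real.exp 1 * x i - τ) else 0)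
      = y + Real.exp 1 * x 0 - τ + ∑ i : Fin m, if (i:ℕ) < p then (Real.exp 1 * Fin.tail x i - τ) else 0 := by
    intro p
    rw [Fin.sum_univ_succ]
    simp [Fin.tail]
    ring
  unfold tube
  simp only [Set.mem_ofPred_eq]
  constructor
  · intro h
    refine ⟨by simpa using h 0 (by omega), fun p hp => ?_⟩
    rw [← key]; exact h (p + 1) (by omega)
  · rintro ⟨h0, h⟩ p hp
    cases p with
    | zero => simpa using h0
    | succ p => rw [key]; exact h p (by omega)

lemma tube_meas (τ H : ℝ) (m : ℕ) : MeasurableSet {z : ℝ × (Fin m → ℝ) | z.2 ∈ tube τ H m z.1} := by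
  have : {z : ℝ × (Fin m → ℝ) | z.2 ∈ tube τ H m z.1}
      = ⋂ p, ⋂ (_ : p ≤ m), {z : ℝ × (Fin m → ℝ) | |z.1 + ∑ i : Fin m, if (i:ℕ) < p then (Real.exp 1 * z.2 i - τ) else 0| ≤ H} := by
    ext z; simp [tube]
  rw [this]
  refine MeasurableSet.iInter fun p => MeasurableSet.iInter fun _ => ?_
  refine measurableSet_le ?_ measurable_const
  have : Measurable fun z : ℝ × (Fin m → ℝ) => z.1 + ∑ i : Fin m, if (i:ℕ) < p then (Real.exp 1 * z.2 i - τ) else 0 := by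
    refine measurable_fst.add (Finset.measurable_sum _ fun i _ => ?_)
    split_ifs <;> fun_prop
  exact this.abs

lemma tube_bound (n : ℕ) (hn : 0 < n) (k : ℝ) (hk : 0 < k) (τ H κ A : ℝ) (hτ : τ = Real.arctan k / k)
    (hH : H = Real.pi / (2 * k)) (hκ : κ = 1 - 1 / (Real.exp 1 * n))
    (hA : A = Real.exp (κ * τ) / (Real.exp 1 * n)) (m : ℕ) : ∀ (y : ℝ), |y| ≤ H →
    ENNReal.ofReal (qsub A κ H k m y) ≤ Measure.pi (fun _ : Fin m => expMeasure ((n:ℝ)⁻¹)) (tube τ H m y) := by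
  have hn' : (0:ℝ) < n := by exact_mod_cast hn
  have := probExp n hn
  induction m with
  | zero =>
    intro y hy
    have h1 : tube τ H 0 y = Set.univ := by
      ext x; simp [tube, hy]
    rw [h1, measure_univ]
    apply ENNReal.ofReal_le_one.2
    unfold qsub
    simp only [pow_zero, one_mul, Nat.cast_zero, zero_mul, sub_zero]
    rw [← Real.exp_add]
    refine (mul_le_of_le_one_right (Real.exp_pos _).le (Real.cos_le_one _)).trans ?_
    apply Real.exp_le_one_iff.2
    have hκ1 : κ ≤ 1 := by rw [hκ]; have : 0 ≤ 1 / (Real.exp 1 * n) := by positivity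
                           linarith
    have hκ0 : 0 ≤ κ := by
      rw [hκ, sub_nonneg, div_le_one (by positivity)]
      have h1 : (1:ℝ) ≤ n := by exact_mod_cast hn
      have h2 : (1:ℝ) ≤ Real.exp 1 := Real.one_le_exp (by norm_num)
      nlinarith
    have := abs_le.1 hy
    nlinarith
  | succ m ih =>
    intro y hy
    set ν := Measure.pi (fun _ : Fin m => expMeasure ((n:ℝ)⁻¹)) with hν
    have hQm : Measurable fun y => ν (tube τ H m y) :=
      measurable_measure_prodMk_left (tube_meas τ H m)
    refine (qsub_step n hn k hk τ H κ A hτ hH hκ hA m y hy _ hQm ih).trans (le_of_eq ?_)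
    have hmp := measurePreserving_piFinSuccAbove (fun _ : Fin (m + 1) => expMeasure ((n:ℝ)⁻¹)) 0
    have hS : MeasurableSet {z : ℝ × (Fin m → ℝ) | z.2 ∈ tube τ H m (y + Real.exp 1 * z.1 - τ)} := by
      have hg : Measurable fun z : ℝ × (Fin m → ℝ) => ((y + Real.exp 1 * z.1 - τ, z.2) : ℝ × (Fin m → ℝ)) := by fun_prop
      exact hg (tube_meas τ H m)
    have h1 := hmp.measure_preimage hS.nullMeasurableSet
    rw [Measure.prod_apply hS] at h1
    refine Eq.trans ?_ (h1.symm.trans ?_)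
    · rfl
    · congr 1
      ext x
      rw [tube_succ]
      simp only [hy, true_and]
      rfl

lemma good_law {n ℓ : ℕ} (hn : 0 < n) (τ H : ℝ) (γ : Path n ℓ) :
    P n (good τ H γ) = Measure.pi (fun _ : Fin ℓ => expMeasure ((n:ℝ)⁻¹)) (tube τ H ℓ 0) := by
  have := probExp n hn
  have hind : iIndepFun (fun i (ω : Sym2 (Fin n) → ℝ) => ω i) (P n) :=
    iIndepFun_pi (X := fun _ x => x) (fun i => aemeasurable_id)
  have h2 := hind.precomp (edge_injective γ)
  have := probP n hn
  rw [iIndepFun_iff_map_fun_eq_pi_map (fun i => (measurable_pi_apply _).aemeasurable)] at h2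
  have h3 : ∀ i, Measure.map (fun ω : Sym2 (Fin n) → ℝ => ω (γ.edge i)) (P n) = expMeasure ((n:ℝ)⁻¹) := by
    intro i
    exact (measurePreserving_eval (fun _ : Sym2 (Fin n) => expMeasure ((n:ℝ)⁻¹)) (γ.edge i)).map_eq
  simp only [h3] at h2
  have hm : MeasurableSet (tube τ H ℓ 0) := by
    have hg : Measurable fun x : Fin ℓ → ℝ => ((0, x) : ℝ × (Fin ℓ → ℝ)) := by fun_prop
    exact hg (tube_meas τ H ℓ)
  rw [← h2, Measure.map_apply (by fun_prop) hm]
  congr 1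
  ext ω
  unfold good tube partialSum
  simp only [Set.mem_ofPred_eq, Set.mem_preimage, zero_add]
  refine forall_congr' fun p => forall_congr' fun hp => ?_
  have : ∑ i : Fin ℓ, (if (i:ℕ) < p then (Real.exp 1 * ω (γ.edge i) - τ) else 0)
      = Real.exp 1 * (∑ i : Fin ℓ, if (i:ℕ) < p then ω (γ.edge i) else 0) - p * τ := by
    have hc : ∑ i : Fin ℓ, (if (i:ℕ) < p then τ else 0) = p * τ := by
      rw [← Finset.sum_filter, Finset.sum_const, nsmul_eq_mul]
      congr 2
      rw [Fin.card_filter_val_lt]; omega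
    rw [← hc, Finset.mul_sum, ← Finset.sum_sub_distrib]
    refine Finset.sum_congr rfl fun i _ => ?_
    split_ifs <;> simp
  rw [this]

end

section
lemma arctan_upper (x : ℝ) (hx : 0 ≤ x) : Real.arctan x ≤ x - x ^ 3 / 3 + x ^ 5 / 5 := by
  have hd : ∀ x : ℝ, HasDerivAt (fun x => x - x ^ 3 / 3 + x ^ 5 / 5 - Real.arctan x)
      (x ^ 6 / (1 + x ^ 2)) x := by
    intro x
    have h0 : (1 + x ^ 2) ≠ 0 := by positivity
    have := (((hasDerivAt_id x).sub ((hasDerivAt_pow 3 x).div_const 3)).add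
      ((hasDerivAt_pow 5 x).div_const 5)).sub (Real.hasDerivAt_arctan x)
    refine HasDerivAt.congr_deriv (f' := _) this ?_
    push_cast
    field_simp
    ring
  have hm : Monotone (fun x : ℝ => x - x ^ 3 / 3 + x ^ 5 / 5 - Real.arctan x) :=
    monotone_of_hasDerivAt_nonneg hd fun x => by simp only [Pi.zero_apply]; positivity
  have := hm hx
  simp at this
  linarith

lemma arctan_lower (x : ℝ) (hx : 0 ≤ x) : x - x ^ 3 / 3 ≤ Real.arctan x := by
  have hd : ∀ x : ℝ, HasDerivAt (fun x => Real.arctan x - (x - x ^ 3 / 3))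
      (x ^ 4 / (1 + x ^ 2)) x := by
    intro x
    have h0 : (1 + x ^ 2) ≠ 0 := by positivity
    have := (Real.hasDerivAt_arctan x).sub ((hasDerivAt_id x).sub ((hasDerivAt_pow 3 x).div_const 3))
    refine HasDerivAt.congr_deriv (f' := _) this ?_
    push_cast
    field_simp
    ring
  have hm : Monotone (fun x : ℝ => Real.arctan x - (x - x ^ 3 / 3)) :=
    monotone_of_hasDerivAt_nonneg hd fun x => by simp only [Pi.zero_apply]; positivity
  have := hm hx
  simp at this
  linarith

lemma arctan_le_self' (x : ℝ) (hx : 0 ≤ x) : Real.arctan x ≤ x := by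
  have hd : ∀ x : ℝ, HasDerivAt (fun x => x - Real.arctan x) (x ^ 2 / (1 + x ^ 2)) x := by
    intro x
    have h0 : (1 + x ^ 2) ≠ 0 := by positivity
    have := (hasDerivAt_id x).sub (Real.hasDerivAt_arctan x)
    refine HasDerivAt.congr_deriv (f' := _) this ?_
    field_simp
    ring
  have hm : Monotone (fun x : ℝ => x - Real.arctan x) :=
    monotone_of_hasDerivAt_nonneg hd fun x => by simp only [Pi.zero_apply]; positivity
  have := hm hx
  simp at this
  linarith

lemma desc_lower (n ℓ : ℕ) (h : 2 * (ℓ * (ℓ + 1)) ≤ n) (hn : 0 < n) :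
    (n:ℝ) ^ (ℓ + 1) / 2 ≤ (n.descFactorial (ℓ + 1) : ℝ) := by
  have hn' : (0:ℝ) < n := by exact_mod_cast hn
  have h1 := Nat.pow_sub_le_descFactorial n (ℓ + 1)
  have hl : ℓ ≤ n := by nlinarith
  have h2 : n + 1 - (ℓ + 1) = n - ℓ := by omega
  rw [h2] at h1
  have h3 : ((n:ℝ) - ℓ) ^ (ℓ + 1) ≤ (n.descFactorial (ℓ + 1) : ℝ) := by
    rw [← Nat.cast_sub hl]; exact_mod_cast h1
  refine le_trans ?_ h3
  have h4 : 1 + ((ℓ + 1 : ℕ):ℝ) * (-(ℓ / n)) ≤ (1 + -((ℓ:ℝ) / n)) ^ (ℓ + 1) := by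
    apply one_add_mul_le_pow
    have : (ℓ:ℝ) / n ≤ 1 := by rw [div_le_one hn']; exact_mod_cast hl
    linarith
  have h5 : ((n:ℝ) - ℓ) = n * (1 + -((ℓ:ℝ) / n)) := by field_simp; ring
  rw [h5, mul_pow, div_eq_mul_inv]
  apply mul_le_mul_of_nonneg_left _ (by positivity)
  refine le_trans ?_ h4
  have h6 : ((ℓ + 1 : ℕ):ℝ) * (ℓ / n) ≤ 1 / 2 := by
    rw [← mul_div_assoc, div_le_iff₀ hn']
    have : (2 * (ℓ * (ℓ + 1)) : ℝ) ≤ n := by exact_mod_cast h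
    push_cast; linarith
  linarith

lemma sqrt_pow_lower (k : ℝ) (ℓ : ℕ) : Real.exp (-(ℓ * k ^ 2 / 2)) ≤ (Real.sqrt (1 + k ^ 2))⁻¹ ^ ℓ := by
  have h1 : Real.sqrt (1 + k ^ 2) ≤ Real.exp (k ^ 2 / 2) := by
    rw [Real.sqrt_le_left (Real.exp_pos _).le, ← Real.exp_nat_mul]
    have := Real.add_one_le_exp (k ^ 2)
    push_cast
    rw [show (2:ℝ) * (k ^ 2 / 2) = k ^ 2 by ring]; linarith
  have h2 : Real.exp (-(k ^ 2 / 2)) ≤ (Real.sqrt (1 + k ^ 2))⁻¹ := by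
    rw [Real.exp_neg]
    exact inv_anti₀ (Real.sqrt_pos.2 (by positivity)) h1
  calc Real.exp (-(ℓ * k ^ 2 / 2)) = Real.exp (-(k ^ 2 / 2)) ^ ℓ := by
        rw [← Real.exp_nat_mul]; congr 1; ring
    _ ≤ _ := pow_le_pow_left₀ (Real.exp_pos _).le h2 _

lemma good_count {n ℓ : ℕ} (hn : 0 < n) (k : ℝ) (hk : 0 < k) (τ H : ℝ) (hτ : τ = Real.arctan k / k)
    (hH : H = Real.pi / (2 * k)) (hl : 2 * (ℓ * (ℓ + 1)) ≤ n)
    (hδ : ℓ * Real.exp (-(2 * H)) ≤ Real.exp (-(ℓ * k ^ 2 / 2)) / 2) :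
    n / 4 * Real.exp (-(5 / 6 * (ℓ * k ^ 2)) - 1 - H) ≤ ∑ γ : Path n ℓ, (P n).real (good τ H γ) := by
  have hn' : (0:ℝ) < n := by exact_mod_cast hn
  have hE0 := Real.exp_pos 1
  have hE1 : (1:ℝ) ≤ Real.exp 1 := Real.one_le_exp (by norm_num)
  have := probP n hn
  have hH0 : 0 < H := by rw [hH]; have := Real.pi_pos; positivity
  have hτ1 : 1 - τ ≤ k ^ 2 / 3 := by
    have := arctan_lower k hk.le
    rw [hτ, sub_le_comm, le_div_iff₀ hk]; nlinarith
  have hτ2 : τ ≤ 1 := by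
    rw [hτ, div_le_one hk]
    exact arctan_le_self' k hk.le
  have hτ0 : 0 ≤ τ := by rw [hτ]; exact div_nonneg (Real.arctan_nonneg.2 hk.le) hk.le
  set κ : ℝ := 1 - 1 / (Real.exp 1 * n) with hκ
  set A : ℝ := Real.exp (κ * τ) / (Real.exp 1 * n) with hA
  have hA0 : 0 < A := by positivity
  have hone : ∀ γ : Path n ℓ, A ^ ℓ * Real.exp (-H) * (Real.exp (-(ℓ * k ^ 2 / 2)) / 2) ≤ (P n).real (good τ H γ) := by
    intro γ
    have h1 := tube_bound n hn k hk τ H κ A hτ hH hκ hA ℓ 0 (by simpa using hH0.le)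
    rw [← good_law hn τ H γ, ENNReal.ofReal_le_iff_le_toReal (measure_ne_top _ _)] at h1
    refine le_trans ?_ h1
    unfold qsub
    simp only [mul_zero, neg_zero, Real.exp_zero, mul_one, Real.cos_zero]
    apply mul_le_mul_of_nonneg_left _ (by positivity)
    have := sqrt_pow_lower k ℓ
    linarith
  refine le_trans ?_ (Finset.sum_le_sum fun γ _ => hone γ)
  rw [Finset.sum_const, Finset.card_univ, card_path, nsmul_eq_mul]
  have hd := desc_lower n ℓ hl hn
  refine le_trans ?_ (mul_le_mul_of_nonneg_right hd (by positivity))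
  have hAl : (n:ℝ) ^ (ℓ + 1) * A ^ ℓ = n * Real.exp (ℓ * (κ * τ - 1)) := by
    rw [hA, div_pow, mul_pow, pow_succ, ← Real.exp_nat_mul, mul_sub, mul_one, Real.exp_sub,
      ← Real.exp_one_pow ℓ]
    field_simp
  have hmain : -(5 / 6 * (ℓ * k ^ 2)) - 1 - H ≤ ℓ * (κ * τ - 1) + (-H) + (-(ℓ * k ^ 2 / 2)) := by
    have h1 : (ℓ:ℝ) * (1 - τ) ≤ ℓ * (k ^ 2 / 3) := mul_le_mul_of_nonneg_left hτ1 (Nat.cast_nonneg _)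
    have h2 : ℓ * (τ * (1 / (Real.exp 1 * n))) ≤ 1 := by
      have hl' : (ℓ:ℝ) ≤ n := by
        have : ℓ ≤ n := by nlinarith
        exact_mod_cast this
      have : τ * (1 / (Real.exp 1 * n)) ≤ 1 * (1 / (1 * n)) := by gcongr
      calc ℓ * (τ * (1 / (Real.exp 1 * n))) ≤ n * (1 * (1 / (1 * n))) := by
            gcongr
        _ = 1 := by field_simp
    have h3 : (ℓ:ℝ) * (κ * τ - 1) = -(ℓ * (1 - τ)) - ℓ * (τ * (1 / (Real.exp 1 * n))) := by
      rw [hκ]; ring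
    rw [h3]; linarith
  calc n / 4 * Real.exp (-(5 / 6 * (ℓ * k ^ 2)) - 1 - H)
      ≤ n / 4 * Real.exp (ℓ * (κ * τ - 1) + (-H) + (-(ℓ * k ^ 2 / 2))) := by
        apply mul_le_mul_of_nonneg_left (Real.exp_le_exp.2 hmain) (by positivity)
    _ = (n:ℝ) ^ (ℓ + 1) / 2 * (A ^ ℓ * Real.exp (-H) * (Real.exp (-(ℓ * k ^ 2 / 2)) / 2)) := by
        rw [Real.exp_add, Real.exp_add]
        linear_combination (-(1:ℝ) / 4 * Real.exp (-H) * Real.exp (-(ℓ * k ^ 2 / 2))) * hAl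

end

section
set_option maxHeartbeats 2000000 in
lemma lower_final : ∀ᶠ n : ℕ in atTop,
    (P n) {ω | ∃ γ : Path n ⌈5 / 10 ^ 6 * Real.log n ^ 3⌉₊,
      weight ω γ ≤ (Real.exp (-1) - (Real.log n ^ 2)⁻¹) * (⌈5 / 10 ^ 6 * Real.log n ^ 3⌉₊ : ℕ)}ᶜ
      ≤ ENNReal.ofReal (Real.exp (-(1 / 2 * Real.log n))) := by
  filter_upwards [log_tendsto.eventually_ge_atTop 10000, ev_log_pow 2 3 (6 / 1000) (by norm_num),
    ev_log_pow 4 6 1 one_pos, ev_log_pow (3 * 8) 9 (1 / 2) (by norm_num),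
    ev_log_pow (36 * 8) 9 (1 / 4) (by norm_num),
    eventually_ge_atTop 2] with n hL hp1 hp2 hp3 hp4 hn2
  have hn : 0 < n := by omega
  have hn' : (0:ℝ) < n := by exact_mod_cast hn
  have := probP n hn
  have hexpL : Real.exp (Real.log n) = n := Real.exp_log hn'
  rw [one_mul, hexpL] at hp2
  set L := Real.log n with hLdef
  set ℓ := ⌈5 / 10 ^ 6 * L ^ 3⌉₊ with hℓ
  have hL0 : 0 < L := by linarith
  have hl1 : 5 / 10 ^ 6 * L ^ 3 ≤ ℓ := Nat.le_ceil _
  have hl2 : (ℓ:ℝ) ≤ 5 / 10 ^ 6 * L ^ 3 + 1 := (Nat.ceil_lt_add_one (by positivity)).le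
  have hL3 : (10000:ℝ) ^ 3 ≤ L ^ 3 := by gcongr
  have hl3 : (ℓ:ℝ) + 1 ≤ L ^ 3 := by nlinarith
  have hl0 : (0:ℝ) ≤ ℓ := Nat.cast_nonneg _
  obtain ⟨k, hk⟩ : ∃ k, k = 100 / L := ⟨_, rfl⟩
  have hk0 : 0 < k := by rw [hk]; positivity
  have hkL : k * L = 100 := by rw [hk]; field_simp
  have hk1 : k ≤ 1 / 100 := by rw [hk, div_le_iff₀ hL0]; linarith
  have hk2 : k ^ 2 ≤ 1 / 10000 := by nlinarith
  have hkk : k ^ 2 * L ^ 3 = 10000 * L := by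
    calc k ^ 2 * L ^ 3 = (k * L) ^ 2 * L := by ring
      _ = _ := by rw [hkL]; norm_num
  have hm1 : 5 / 100 * L ≤ ℓ * k ^ 2 := by nlinarith [mul_le_mul_of_nonneg_right hl1 (sq_nonneg k)]
  have hm2 : ℓ * k ^ 2 ≤ 5 / 100 * L + 1 := by
    nlinarith [mul_le_mul_of_nonneg_right hl2 (sq_nonneg k)]
  obtain ⟨H, hH⟩ : ∃ H, H = Real.pi / (2 * k) := ⟨_, rfl⟩
  have hH' : H = Real.pi * L / 200 := by
    rw [hH, hk]; field_simp; norm_num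
  have hpi1 := Real.pi_gt_d2
  have hpi2 := Real.pi_lt_d2
  have hH1 : 157 / 10000 * L ≤ H := by rw [hH']; nlinarith
  have hH2 : H ≤ 1575 / 100000 * L := by rw [hH']; nlinarith
  obtain ⟨τ, hτ⟩ : ∃ τ, τ = Real.arctan k / k := ⟨_, rfl⟩
  have hτ1 : 1 - τ ≤ k ^ 2 / 3 := by
    have := arctan_lower k hk0.le
    have : 1 - k ^ 2 / 3 ≤ τ := by
      rw [hτ, le_div_iff₀ hk0]; nlinarith
    linarith
  have hτ2 : k ^ 2 / 3 - k ^ 4 / 5 ≤ 1 - τ := by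
    have := arctan_upper k hk0.le
    have : τ ≤ 1 - k ^ 2 / 3 + k ^ 4 / 5 := by
      rw [hτ, div_le_iff₀ hk0]; nlinarith
    linarith
  have hE1 := Real.exp_one_lt_d9
  have hE0 := Real.exp_one_gt_d9
  have hLk : (L ^ 2)⁻¹ = k ^ 2 / 10000 := by
    rw [hk]; field_simp; norm_num
  have hend : ℓ * τ + H ≤ ℓ - Real.exp 1 * ((L ^ 2)⁻¹ * ℓ) := by
    rw [hLk]
    have h1 : ℓ * (k ^ 2 / 3 - k ^ 4 / 5) ≤ ℓ * (1 - τ) := mul_le_mul_of_nonneg_left hτ2 hl0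
    have h2 : ℓ * k ^ 4 / 5 ≤ ℓ * k ^ 2 * (1 / 50000) := by
      have : ℓ * k ^ 2 * k ^ 2 ≤ ℓ * k ^ 2 * (1 / 10000) :=
        mul_le_mul_of_nonneg_left hk2 (by positivity)
      have e : ℓ * k ^ 4 = ℓ * k ^ 2 * k ^ 2 := by ring
      rw [e]; linarith
    have h3 : Real.exp 1 * (k ^ 2 / 10000 * ℓ) ≤ 3 * (k ^ 2 / 10000 * ℓ) := by
      apply mul_le_mul_of_nonneg_right (by linarith) (by positivity)
    linarith
  have hτle : τ ≤ 1 := by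
    have e : k ^ 4 = k ^ 2 * k ^ 2 := by ring
    have h := mul_le_mul_of_nonneg_left hk2 (sq_nonneg k)
    have := sq_nonneg k
    rw [← e] at h
    linarith
  have hθ : ℓ * τ + H ≤ ℓ := by
    have : 0 ≤ Real.exp 1 * ((L ^ 2)⁻¹ * ℓ) := by positivity
    linarith
  have hl : 2 * (ℓ * (ℓ + 1)) ≤ n := by
    have : (2:ℝ) * (ℓ * (ℓ + 1)) ≤ n := by
      have : (ℓ:ℝ) * (ℓ + 1) ≤ L ^ 3 * L ^ 3 := by
        apply mul_le_mul (by linarith) hl3 (by positivity) (by positivity)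
      have h6 : 0 ≤ L ^ 6 := by positivity
      nlinarith
    exact_mod_cast this
  have hδ : ℓ * Real.exp (-(2 * H)) ≤ Real.exp (-(ℓ * k ^ 2 / 2)) / 2 := by
    have h1 : 2 * (ℓ:ℝ) ≤ Real.exp (6 / 1000 * L) := by linarith
    have h2 : 2 * (ℓ:ℝ) * Real.exp (-(2 * H)) ≤ Real.exp (-(ℓ * k ^ 2 / 2)) := by
      refine (mul_le_mul_of_nonneg_right h1 (Real.exp_nonneg _)).trans ?_
      rw [← Real.exp_add]
      apply Real.exp_le_exp.2
      linarith
    linarith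
  have hcube : ((ℓ:ℝ) + 1) ^ 3 ≤ L ^ 9 := by
    calc ((ℓ:ℝ) + 1) ^ 3 ≤ (L ^ 3) ^ 3 := by gcongr
      _ = L ^ 9 := by ring
  have hL9 : 0 ≤ L ^ 9 := by positivity
  have hτ3 : ℓ * (1 - τ) ≤ ℓ * k ^ 2 / 3 := by
    have := mul_le_mul_of_nonneg_left hτ1 hl0
    linarith
  have hR : 3 * ((ℓ:ℝ) + 1) ^ 3 * Real.exp (2 * H + ℓ * (1 - τ)) ≤ n := by
    have h1 : 3 * ((ℓ:ℝ) + 1) ^ 3 ≤ Real.exp (1 / 2 * L) := by linarith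
    refine (mul_le_mul_of_nonneg_right h1 (Real.exp_nonneg _)).trans ?_
    rw [← Real.exp_add, ← hexpL]
    apply Real.exp_le_exp.2
    linarith
  have hcount := good_count hn k hk0 τ H hτ hH hl hδ
  have hng := no_good hn τ H hτle hθ hR _ (by positivity) hcount
  have hratio : 9 * ((ℓ:ℝ) + 1) ^ 3 * Real.exp (2 * H + ℓ * (1 - τ)) /
      (n / 4 * Real.exp (-(5 / 6 * (ℓ * k ^ 2)) - 1 - H)) ≤ Real.exp (-(1 / 2 * L)) := by
    rw [div_le_iff₀ (by positivity)]
    have h1 : 36 * ((ℓ:ℝ) + 1) ^ 3 ≤ Real.exp (1 / 4 * L) := by linarith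
    have h2 : 36 * ((ℓ:ℝ) + 1) ^ 3 * Real.exp (2 * H + ℓ * (1 - τ)) ≤
        Real.exp (-(1 / 2 * L)) * (n * Real.exp (-(5 / 6 * (ℓ * k ^ 2)) - 1 - H)) := by
      refine (mul_le_mul_of_nonneg_right h1 (Real.exp_nonneg _)).trans ?_
      rw [← hexpL, ← Real.exp_add, ← Real.exp_add, ← Real.exp_add]
      apply Real.exp_le_exp.2
      linarith
    linarith
  have hfin := hng.trans hratio
  have hsub : {ω | ∃ γ : Path n ℓ, weight ω γ ≤ (Real.exp (-1) - (L ^ 2)⁻¹) * (ℓ : ℕ)}ᶜ ⊆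
      (⋃ γ : Path n ℓ, good τ H γ)ᶜ := by
    apply Set.compl_subset_compl.2
    intro ω hω
    obtain ⟨γ, hγ⟩ := Set.mem_iUnion.1 hω
    refine ⟨γ, ?_⟩
    have h1 := (abs_le.1 (hγ ℓ le_rfl)).2
    rw [partialSum_top] at h1
    have h2 : Real.exp 1 * weight ω γ ≤ ℓ - Real.exp 1 * ((L ^ 2)⁻¹ * ℓ) := by linarith
    have h3 : Real.exp 1 * Real.exp (-1) = 1 := by rw [← Real.exp_add]; simp
    have h4 : Real.exp 1 * weight ω γ ≤ Real.exp 1 * ((Real.exp (-1) - (L ^ 2)⁻¹) * ℓ) := by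
      have : Real.exp 1 * ((Real.exp (-1) - (L ^ 2)⁻¹) * ℓ) =
        (Real.exp 1 * Real.exp (-1)) * ℓ - Real.exp 1 * ((L ^ 2)⁻¹ * ℓ) := by ring
      rw [this, h3]; linarith
    exact le_of_mul_le_mul_left h4 (Real.exp_pos _)
  refine (measure_mono hsub).trans ?_
  rw [← ENNReal.ofReal_toReal (measure_ne_top (P n) _)]
  exact ENNReal.ofReal_le_ofReal hfin

end

lemma L_set_bdd (n : ℕ) (lam : ℝ) (ω : Sym2 (Fin n) → ℝ) :
    BddAbove {ℓ : ℕ | ∃ γ : Path n ℓ, weight ω γ ≤ lam * ℓ} := by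
  refine ⟨n, ?_⟩
  rintro ℓ ⟨γ, -⟩
  have := Fintype.card_le_of_injective _ γ.2
  simp at this
  omega

/-- Theorem 1 (critical window): there are absolute constants α, C, c > 0 such that
uniformly over e⁻¹ - (log n)⁻² ≤ λ ≤ e⁻¹ + α (log n)⁻², with probability tending to one,
c (log n)³ ≤ L(n,λ) ≤ C (log n)³. -/
theorem critical_window :
    ∃ α C c : ℝ, 0 < α ∧ 0 < C ∧ 0 < c ∧
      Tendsto (fun n : ℕ =>
          ⨅ lam ∈ Set.Icc (Real.exp (-1) - ((Real.log n) ^ 2)⁻¹)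
              (Real.exp (-1) + α * ((Real.log n) ^ 2)⁻¹),
            P n {ω | c * (Real.log n) ^ 3 ≤ (L n lam ω : ℝ) ∧
                     (L n lam ω : ℝ) ≤ C * (Real.log n) ^ 3})
        atTop (nhds 1) := by
  refine ⟨1 / 10 ^ 7, 10 ^ 7, 5 / 10 ^ 6, by norm_num, by norm_num, by norm_num, ?_⟩
  have hlim : Tendsto (fun n : ℕ => (1:ENNReal) -
      (ENNReal.ofReal (Real.exp (-(1 / 2 * Real.log n))) + ENNReal.ofReal (3 / n)))
      atTop (nhds 1) := by
    have h1 : Tendsto (fun n : ℕ => Real.exp (-(1 / 2 * Real.log n))) atTop (nhds 0) := by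
      apply Real.tendsto_exp_neg_atTop_nhds_zero.comp
      exact log_tendsto.const_mul_atTop (by norm_num)
    have h2 : Tendsto (fun n : ℕ => (3:ℝ) / n) atTop (nhds 0) :=
      tendsto_const_div_atTop_nhds_zero_nat 3
    have h3 := (ENNReal.tendsto_ofReal h1).add (ENNReal.tendsto_ofReal h2)
    have h4 := ENNReal.Tendsto.sub (tendsto_const_nhds (x := (1:ENNReal))) h3
      (Or.inl ENNReal.one_ne_top)
    simpa using h4
  refine tendsto_of_tendsto_of_tendsto_of_le_of_le' hlim tendsto_const_nhds ?_ ?_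
  · filter_upwards [lower_final, upper_final, eventually_ge_atTop 2,
      log_tendsto.eventually_ge_atTop 1] with n h1 h2 hn2 hL
    have := probP n (by omega)
    refine le_iInf₂ fun lam hlam => ?_
    set B1 := {ω | ∃ γ : Path n ⌈5 / 10 ^ 6 * Real.log n ^ 3⌉₊,
      weight ω γ ≤ (Real.exp (-1) - (Real.log n ^ 2)⁻¹) * (⌈5 / 10 ^ 6 * Real.log n ^ 3⌉₊ : ℕ)}ᶜ
      with hB1
    set B2 := {ω : Sym2 (Fin n) → ℝ | ∃ ℓ : ℕ, 10 ^ 7 * Real.log n ^ 3 < ℓ ∧ ∃ γ : Path n ℓ,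
      weight ω γ ≤ (Real.exp (-1) + 1 / 10 ^ 7 * (Real.log n ^ 2)⁻¹) * ℓ} with hB2
    set G := {ω | 5 / 10 ^ 6 * (Real.log n) ^ 3 ≤ (L n lam ω : ℝ) ∧
                     (L n lam ω : ℝ) ≤ 10 ^ 7 * (Real.log n) ^ 3} with hG
    have hcov : Set.univ ⊆ G ∪ (B1 ∪ B2) := by
      intro ω _
      by_cases hb1 : ω ∈ B1
      · exact Or.inr (Or.inl hb1)
      by_cases hb2 : ω ∈ B2
      · exact Or.inr (Or.inr hb2)
      left
      rw [hB1, Set.notMem_compl_iff] at hb1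
      obtain ⟨γ, hγ⟩ := hb1
      have hmem : ⌈5 / 10 ^ 6 * Real.log n ^ 3⌉₊ ∈
          {ℓ : ℕ | ∃ γ : Path n ℓ, weight ω γ ≤ lam * ℓ} :=
        ⟨γ, hγ.trans (mul_le_mul_of_nonneg_right hlam.1 (Nat.cast_nonneg _))⟩
      constructor
      · refine (Nat.le_ceil _).trans ?_
        exact_mod_cast le_csSup (L_set_bdd n lam ω) hmem
      · obtain ⟨γ', hγ'⟩ := Nat.sSup_mem ⟨_, hmem⟩ (L_set_bdd n lam ω)
        by_contra hcon
        push Not at hcon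
        exact hb2 ⟨L n lam ω, hcon, γ',
          hγ'.trans (mul_le_mul_of_nonneg_right hlam.2 (Nat.cast_nonneg _))⟩
    have hm : (1:ENNReal) ≤ P n G + (P n B1 + P n B2) := by
      calc (1:ENNReal) = P n Set.univ := measure_univ.symm
        _ ≤ P n (G ∪ (B1 ∪ B2)) := measure_mono hcov
        _ ≤ _ := (measure_union_le _ _).trans (by gcongr; exact measure_union_le _ _)
    rw [tsub_le_iff_right]
    refine hm.trans ?_
    gcongr
  · filter_upwards [eventually_ge_atTop 2] with n hn2
    have := probP n (by omega)
    refine (iInf₂_le (Real.exp (-1)) ⟨?_, ?_⟩).trans prob_le_one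
    · have : 0 ≤ (Real.log n ^ 2)⁻¹ := by positivity
      linarith
    · have : 0 ≤ 1 / 10 ^ 7 * (Real.log n ^ 2)⁻¹ := by positivity
      linarith

end Paper
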